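/- arXiv:1905.03009 — 10 statements merged into one kernel-verified Lean document; each statement's English description precedes it below -/
import Mathlib

section
/- Let P and Q be probability measures on a measurable space (X, 𝒜) having densities f and g, respectively, with respect to a σ-finite measure μ, and let ρ ∈ [1,∞) be such that g ≤ ρ·f μ-almost everywhere. Then for every non-decreasing function ψ : [0,∞) → ℝ with ψ(1) = 0, one has ∫_{{f>0}} ψ(g/f) dQ ≤ Q({g > f}) · ψ(ρ). -/
open MeasureTheory

/-- Proposition 1(a): if `Q` and `P` have `μ`-densities `g` and `f` with `g ≤ ρ·f`
`μ`-a.e., then for any non-decreasing `ψ` on `[0,∞)` with `ψ 1 = 0`,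
`∫_{f>0} ψ(g/f) dQ ≤ Q({g > f}) * ψ ρ`. -/
theorem ratio_bound_monotone
    {X : Type*} [MeasurableSpace X] (μ P Q : Measure X) [SigmaFinite μ]
    [IsProbabilityMeasure P] [IsProbabilityMeasure Q]
    (f g : X → ℝ) (hf : Measurable f) (hg : Measurable g)
    (hf0 : ∀ x, 0 ≤ f x) (hg0 : ∀ x, 0 ≤ g x)
    (hP : ∀ A : Set X, MeasurableSet A → P A = ∫⁻ x in A, ENNReal.ofReal (f x) ∂μ)
    (hQ : ∀ A : Set X, MeasurableSet A → Q A = ∫⁻ x in A, ENNReal.ofReal (g x) ∂μ)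
    (ρ : ℝ) (hρ : 1 ≤ ρ) (hbound : ∀ᵐ x ∂μ, g x ≤ ρ * f x)
    (ψ : ℝ → ℝ) (hψ : MonotoneOn ψ (Set.Ici 0)) (hψ1 : ψ 1 = 0)
    (hint : IntegrableOn (fun x => ψ (g x / f x)) {x | 0 < f x} Q) :
    ∫ x in {x | 0 < f x}, ψ (g x / f x) ∂Q ≤ (Q {x | f x < g x}).toReal * ψ ρ := by
  have hQac : Q ≪ μ := by
    have : Q = μ.withDensity (fun x => ENNReal.ofReal (g x)) := by
      ext A hA
      rw [hQ A hA, withDensity_apply _ hA]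
    rw [this]
    exact withDensity_absolutelyContinuous _ _
  have hb : ∀ᵐ x ∂Q, g x ≤ ρ * f x := hQac.ae_le hbound
  have hS : MeasurableSet {x | 0 < f x} := measurableSet_lt measurable_const hf
  have hT : MeasurableSet {x | f x < g x} := measurableSet_lt hf hg
  have hρ0 : (0 : ℝ) ≤ ρ := by linarith
  have hψρ : 0 ≤ ψ ρ := by
    rw [← hψ1]
    exact hψ (Set.mem_Ici.2 zero_le_one) (Set.mem_Ici.2 hρ0) hρ
  have hI : Integrable ({x | f x < g x}.indicator (fun _ => ψ ρ)) Q :=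
    (integrable_const _).indicator hT
  calc ∫ x in {x | 0 < f x}, ψ (g x / f x) ∂Q
      ≤ ∫ x in {x | 0 < f x}, {x | f x < g x}.indicator (fun _ => ψ ρ) x ∂Q := by
        refine setIntegral_mono_on_ae hint hI.integrableOn hS ?_
        filter_upwards [hb] with x hx hfx
        have hfx : 0 < f x := hfx
        have h0 : 0 ≤ g x / f x := div_nonneg (hg0 x) hfx.le
        by_cases h : f x < g x
        · rw [Set.indicator_of_mem (by exact h)]
          exact hψ h0 hρ0 ((div_le_iff₀ hfx).2 hx)
        · rw [Set.indicator_of_notMem (by exact h), ← hψ1]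
          exact hψ h0 (Set.mem_Ici.2 zero_le_one) ((div_le_one hfx).2 (not_lt.1 h))
    _ ≤ ∫ x, {x | f x < g x}.indicator (fun _ => ψ ρ) x ∂Q :=
        setIntegral_le_integral hI
          (Filter.Eventually.of_forall fun x => Set.indicator_nonneg (fun _ _ => hψρ) x)
    _ = (Q {x | f x < g x}).toReal * ψ ρ := by
        rw [integral_indicator_const _ hT]
        rfl
end

section
/- Let P and Q be probability measures on a measurable space (X, 𝒜) having densities f and g, respectively, with respect to a σ-finite measure μ, and let ρ ∈ [1,∞) be such that g ≤ ρ·f μ-almost everywhere. Then for every continuous convex function ψ : [0,∞) → ℝ, one has ∫_{{f>0}} ψ(g/f) dP ≤ ψ(0) + (ψ(ρ) − ψ(0))/ρ. -/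
open MeasureTheory

/-- Proposition 1(b): if `Q` and `P` have `μ`-densities `g` and `f` with `g ≤ ρ·f`
`μ`-a.e., then for any continuous convex `ψ` on `[0,∞)`,
`∫_{f>0} ψ(g/f) dP ≤ ψ 0 + (ψ ρ - ψ 0)/ρ`. -/
theorem ratio_bound_convex
    {X : Type*} [MeasurableSpace X] (μ P Q : Measure X) [SigmaFinite μ]
    [IsProbabilityMeasure P] [IsProbabilityMeasure Q]
    (f g : X → ℝ) (hf : Measurable f) (hg : Measurable g)
    (hf0 : ∀ x, 0 ≤ f x) (hg0 : ∀ x, 0 ≤ g x)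
    (hP : ∀ A : Set X, MeasurableSet A → P A = ∫⁻ x in A, ENNReal.ofReal (f x) ∂μ)
    (hQ : ∀ A : Set X, MeasurableSet A → Q A = ∫⁻ x in A, ENNReal.ofReal (g x) ∂μ)
    (ρ : ℝ) (hρ : 1 ≤ ρ) (hbound : ∀ᵐ x ∂μ, g x ≤ ρ * f x)
    (ψ : ℝ → ℝ) (hψ : ConvexOn ℝ (Set.Ici 0) ψ) (hψc : ContinuousOn ψ (Set.Ici 0))
    (hint : IntegrableOn (fun x => ψ (g x / f x)) {x | 0 < f x} P) :
    ∫ x in {x | 0 < f x}, ψ (g x / f x) ∂P ≤ ψ 0 + (ψ ρ - ψ 0) / ρ := by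
  have hρ0 : 0 < ρ := by linarith
  have hPd : P = μ.withDensity (fun x => ENNReal.ofReal (f x)) := by
    ext A hA
    rw [hP A hA, withDensity_apply _ hA]
  have hfm : Measurable (fun x => ENNReal.ofReal (f x)) := hf.ennreal_ofReal
  have hS : MeasurableSet {x | 0 < f x} := measurableSet_lt measurable_const hf
  have hpos : ∀ᵐ x ∂P, 0 < f x := by
    rw [hPd, ae_withDensity_iff hfm]
    refine Filter.Eventually.of_forall fun x hx => ?_
    simpa using hx
  have hres : P.restrict {x | 0 < f x} = P := Measure.restrict_eq_self_of_ae_mem hpos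
  have hbP : ∀ᵐ x ∂P, g x ≤ ρ * f x := by
    rw [hPd]
    exact (withDensity_absolutelyContinuous μ _).ae_le hbound
  have hle : ∀ᵐ x ∂P, g x / f x ≤ ρ := by
    filter_upwards [hpos, hbP] with x h1 h2
    rwa [div_le_iff₀ h1]
  have hnn : ∀ x, 0 ≤ g x / f x := fun x => div_nonneg (hg0 x) (hf0 x)
  have hrm : Measurable (fun x => g x / f x) := hg.div hf
  have hl : ∫⁻ x, ENNReal.ofReal (g x / f x) ∂P = 1 := by
    have h1 : ∫⁻ x, ENNReal.ofReal (g x) ∂μ = 1 := by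
      have := hQ Set.univ MeasurableSet.univ
      rw [measure_univ, Measure.restrict_univ] at this
      exact this.symm
    rw [hPd, lintegral_withDensity_eq_lintegral_mul _ hfm hrm.ennreal_ofReal, ← h1]
    refine lintegral_congr_ae ?_
    filter_upwards [hbound] with x hx
    rw [Pi.mul_apply, ← ENNReal.ofReal_mul (hf0 x)]
    congr 1
    rcases (hf0 x).eq_or_lt with h | h
    · rw [← h] at hx ⊢
      have := hg0 x
      linarith
    · field_simp
  have hri : Integrable (fun x => g x / f x) P := by
    refine ⟨hrm.aestronglyMeasurable, ?_⟩
    rw [hasFiniteIntegral_iff_ofReal (Filter.Eventually.of_forall hnn), hl]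
    exact ENNReal.one_lt_top
  have hr1 : ∫ x, g x / f x ∂P = 1 := by
    rw [integral_eq_lintegral_of_nonneg_ae (Filter.Eventually.of_forall hnn)
      hrm.aestronglyMeasurable, hl, ENNReal.toReal_one]
  have hint' : Integrable (fun x => ψ (g x / f x)) P := by
    rw [IntegrableOn, hres] at hint
    exact hint
  rw [hres]
  calc ∫ x, ψ (g x / f x) ∂P
      ≤ ∫ x, (ψ 0 + (g x / f x) * ((ψ ρ - ψ 0) / ρ)) ∂P := by
        refine integral_mono_ae hint' ((integrable_const _).add (hri.mul_const _)) ?_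
        filter_upwards [hle] with x hx
        have ht := hnn x
        generalize g x / f x = t at hx ht
        have h := hψ.2 (Set.mem_Ici.2 le_rfl) (Set.mem_Ici.2 hρ0.le)
          (show 0 ≤ 1 - t / ρ by rw [sub_nonneg, div_le_one hρ0]; exact hx)
          (show 0 ≤ t / ρ by positivity) (by ring)
        simp only [smul_eq_mul, mul_zero, zero_add] at h
        rw [div_mul_cancel₀ _ hρ0.ne'] at h
        refine h.trans (le_of_eq ?_)
        ring
    _ = ψ 0 + (ψ ρ - ψ 0) / ρ := by
        rw [integral_add (integrable_const _) (hri.mul_const _), integral_mul_const, hr1]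
        simp
end

section
/- Let P and Q be probability measures on a measurable space (X, 𝒜) having densities f and g, respectively, with respect to a σ-finite measure μ, and let ρ ∈ [1,∞) be such that g ≤ ρ·f μ-almost everywhere. Then d_TV(Q,P) ≤ Q({g > f}) · (1 − ρ^{−1}). -/
open MeasureTheory

/-- The total variation distance `sup_A |Q(A) - P(A)|`. -/
noncomputable def tvDist {X : Type*} [MeasurableSpace X] (Q P : Measure X) : ℝ :=
  ⨆ A : {A : Set X // MeasurableSet A}, |(Q A.1).toReal - (P A.1).toReal|

/-- If `Q` and `P` have `μ`-densities `g` and `f` with `g ≤ ρ·f` `μ`-a.e., then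
`d_TV(Q,P) ≤ Q({g > f}) * (1 - ρ⁻¹)`. -/
theorem tv_bound_via_ratio
    {X : Type*} [MeasurableSpace X] (μ P Q : Measure X) [SigmaFinite μ]
    [IsProbabilityMeasure P] [IsProbabilityMeasure Q]
    (f g : X → ℝ) (hf : Measurable f) (hg : Measurable g)
    (hf0 : ∀ x, 0 ≤ f x) (hg0 : ∀ x, 0 ≤ g x)
    (hP : ∀ A : Set X, MeasurableSet A → P A = ∫⁻ x in A, ENNReal.ofReal (f x) ∂μ)
    (hQ : ∀ A : Set X, MeasurableSet A → Q A = ∫⁻ x in A, ENNReal.ofReal (g x) ∂μ)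
    (ρ : ℝ) (hρ : 1 ≤ ρ) (hbound : ∀ᵐ x ∂μ, g x ≤ ρ * f x) :
    tvDist Q P ≤ (Q {x | f x < g x}).toReal * (1 - ρ⁻¹) := by
  have hS : MeasurableSet {x | f x < g x} := measurableSet_lt hf hg
  have hρ0 : 0 < ρ := by linarith
  have hinv : ρ⁻¹ ≤ 1 := inv_le_one_of_one_le₀ hρ
  have hratio : ∀ A : Set X, MeasurableSet A → (Q A).toReal ≤ ρ * (P A).toReal := by
    intro A hA
    have h : Q A ≤ ENNReal.ofReal ρ * P A := by
      rw [hQ A hA, hP A hA, ← lintegral_const_mul _ hf.ennreal_ofReal]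
      apply lintegral_mono_ae
      filter_upwards [ae_restrict_of_ae hbound] with x hx
      rw [← ENNReal.ofReal_mul hρ0.le]
      exact ENNReal.ofReal_le_ofReal hx
    have h2 := ENNReal.toReal_mono
      (ENNReal.mul_ne_top ENNReal.ofReal_ne_top (measure_ne_top P A)) h
    rwa [ENNReal.toReal_mul, ENNReal.toReal_ofReal hρ0.le] at h2
  have hout : ∀ A : Set X, MeasurableSet A →
      (Q (A \ {x | f x < g x})).toReal ≤ (P (A \ {x | f x < g x})).toReal := by
    intro A hA
    apply ENNReal.toReal_mono (measure_ne_top P _)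
    rw [hQ _ (hA.diff hS), hP _ (hA.diff hS)]
    apply setLIntegral_mono' (hA.diff hS)
    intro x hx
    exact ENNReal.ofReal_le_ofReal (not_lt.mp hx.2)
  have key : ∀ A : Set X, MeasurableSet A →
      (Q A).toReal - (P A).toReal ≤ (Q {x | f x < g x}).toReal * (1 - ρ⁻¹) := by
    intro A hA
    have e1 : (Q (A ∩ {x | f x < g x})).toReal + (Q (A \ {x | f x < g x})).toReal
        = (Q A).toReal := measureReal_inter_add_diff (μ := Q) hS
    have e2 : (P (A ∩ {x | f x < g x})).toReal + (P (A \ {x | f x < g x})).toReal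
        = (P A).toReal := measureReal_inter_add_diff (μ := P) hS
    have h1 := hout A hA
    have h2 := hratio _ (hA.inter hS)
    have h3 : (Q (A ∩ {x | f x < g x})).toReal ≤ (Q {x | f x < g x}).toReal :=
      ENNReal.toReal_mono (measure_ne_top Q _) (measure_mono Set.inter_subset_right)
    have h4 : ρ⁻¹ * (Q (A ∩ {x | f x < g x})).toReal ≤ (P (A ∩ {x | f x < g x})).toReal := by
      rwa [inv_mul_le_iff₀ hρ0]
    have h5 := mul_le_mul_of_nonneg_right h3 (sub_nonneg.mpr hinv)
    linarith
  haveI : Nonempty {A : Set X // MeasurableSet A} := ⟨⟨∅, MeasurableSet.empty⟩⟩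
  unfold tvDist
  apply ciSup_le
  rintro ⟨A, hA⟩
  rw [abs_le]
  have hc := key Aᶜ hA.compl
  have q1 : (Q Aᶜ).toReal = 1 - (Q A).toReal := probReal_compl_eq_one_sub hA
  have p1 : (P Aᶜ).toReal = 1 - (P A).toReal := probReal_compl_eq_one_sub hA
  exact ⟨by simp only; linarith, key A hA⟩
end

section
/- For all integers n, N with 1 ≤ n ≤ N, one has n(n−1)/(2N) ≤ log(N^n / [N]_n) ≤ −(n/2)·log(1 − (n−1)/N), where [N]_n = N(N−1)⋯(N−n+1) is the falling factorial. -/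
theorem log_ratio_eq_sum (N : ℕ) : ∀ n : ℕ, n ≤ N →
    Real.log ((N : ℝ) ^ n / (N.descFactorial n : ℝ)) =
      ∑ j ∈ Finset.range n, -Real.log (1 - (j : ℝ) / N) := by
  intro n
  induction n with
  | zero => intro _; simp
  | succ k ih =>
    intro h
    have hN : (0 : ℝ) < N := by exact_mod_cast (by omega : 0 < N)
    have hk : (0 : ℝ) < (N : ℝ) - k := by
      have : (k : ℝ) < N := by exact_mod_cast (by omega : k < N)
      linarith
    have hd : (0 : ℝ) < (N.descFactorial k : ℝ) := by
      exact_mod_cast Nat.descFactorial_pos.2 (by omega : k ≤ N)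
    rw [Finset.sum_range_succ, ← ih (by omega), Nat.descFactorial_succ, Nat.cast_mul,
      Nat.cast_sub (by omega)]
    have e : (1 : ℝ) - k / N = (N - k) / N := by field_simp
    rw [e, ← Real.log_inv, ← Real.log_mul (by positivity) (by positivity)]
    congr 1
    field_simp
    ring

theorem sum_lower (N : ℝ) (n : ℕ) :
    (n : ℝ) * ((n : ℝ) - 1) / (2 * N) = ∑ j ∈ Finset.range n, (j : ℝ) / N := by
  induction n with
  | zero => simp
  | succ k ih =>
    rw [Finset.sum_range_succ, ← ih]
    push_cast
    by_cases h : N = 0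
    · simp [h]
    · field_simp
      ring

/-- Bounds on `log(N^n / [N]_n)` where `[N]_n` is the falling factorial:
`n(n-1)/(2N) ≤ log(N^n/[N]_n) ≤ -(n/2)·log(1 - (n-1)/N)`. -/
theorem log_ratio_sampling_bounds (n N : ℕ) (hn : 1 ≤ n) (hnN : n ≤ N) :
    (n : ℝ) * ((n : ℝ) - 1) / (2 * N) ≤
      Real.log ((N : ℝ) ^ n / (N.descFactorial n : ℝ)) ∧
    Real.log ((N : ℝ) ^ n / (N.descFactorial n : ℝ)) ≤
      -((n : ℝ) / 2) * Real.log (1 - ((n : ℝ) - 1) / N) := by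
  have hN : (0 : ℝ) < N := by exact_mod_cast (by omega : 0 < N)
  have hpos : ∀ j : ℕ, j < n → (0 : ℝ) < 1 - (j : ℝ) / N := by
    intro j hj
    have : (j : ℝ) < N := by exact_mod_cast (by omega : j < N)
    rw [sub_pos, div_lt_one hN]
    exact this
  rw [log_ratio_eq_sum N n hnN]
  constructor
  · rw [sum_lower]
    apply Finset.sum_le_sum
    intro j hj
    have := Real.log_le_sub_one_of_pos (hpos j (Finset.mem_range.1 hj))
    linarith
  · have hr := Finset.sum_range_reflect (fun j : ℕ => -Real.log (1 - (j : ℝ) / N)) n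
    have hs : ∑ j ∈ Finset.range n, (-Real.log (1 - ((n - 1 - j : ℕ) : ℝ) / N)
        + -Real.log (1 - (j : ℝ) / N)) ≤
        ∑ j ∈ Finset.range n, -Real.log (1 - ((n : ℝ) - 1) / N) := by
      apply Finset.sum_le_sum
      intro j hj
      have hj := Finset.mem_range.1 hj
      have h1 := hpos j hj
      have h2 := hpos (n - 1 - j) (by omega)
      have h3 := hpos (n - 1) (by omega)
      have e : ((n - 1 - j : ℕ) : ℝ) = (n : ℝ) - 1 - j := by
        rw [Nat.cast_sub (by omega), Nat.cast_sub hn, Nat.cast_one]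
      rw [Nat.cast_sub hn, Nat.cast_one] at h3
      have hl : Real.log (1 - ((n : ℝ) - 1) / N) ≤
          Real.log ((1 - ((n - 1 - j : ℕ) : ℝ) / N) * (1 - (j : ℝ) / N)) := by
        apply Real.log_le_log h3
        have hp : 0 ≤ ((n - 1 - j : ℕ) : ℝ) / N * ((j : ℝ) / N) := by positivity
        have es : ((n : ℝ) - 1) / N = ((n - 1 - j : ℕ) : ℝ) / N + (j : ℝ) / N := by
          rw [e]; ring
        rw [es]
        nlinarith
      rw [Real.log_mul h2.ne' h1.ne'] at hl
      linarith
    rw [Finset.sum_add_distrib, hr, Finset.sum_const, Finset.card_range, nsmul_eq_mul] at hs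
    linarith
end

section
/- Let N, L, n be integers with 1 ≤ n ≤ N, n − 1 ≤ N/2 and 0 ≤ L ≤ N. Then for every k ∈ {0,1,…,n}, the hypergeometric probability Hyp(N,L,n)({k}) = C(L,k)·C(N−L,n−k)/C(N,n) satisfies Hyp(N,L,n)({k}) ≤ (1 − 1/N)^{−(n−1)} · Bin(n, L/N)({k}), where Bin(n,L/N)({k}) = C(n,k)(L/N)^k(1−L/N)^{n−k}. Moreover, for L = 1 the supremum over k of the ratio Hyp(N,1,n)({k})/Bin(n,1/N)({k}) equals (1 − 1/N)^{−(n−1)}, and (1 − 1/N)^{−(n−1)} ≤ (1 − (n−1)/N)^{−1}. -/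
/-- pmf of the hypergeometric distribution `Hyp(N,L,n)`. -/
noncomputable def hypPMF (N L n : ℕ) (k : ℕ) : ℝ :=
  (L.choose k * (N - L).choose (n - k) : ℝ) / (N.choose n : ℝ)

/-- pmf of the binomial distribution `Bin(n,p)`. -/
noncomputable def binPMF (n : ℕ) (p : ℝ) (k : ℕ) : ℝ :=
  (n.choose k : ℝ) * p ^ k * (1 - p) ^ (n - k)

lemma stir_up (v : ℝ) (hv : 0 < v) :
    (v + 1/2) * Real.log (1 + 1/v) ≤ 1 + 1/(12 * v * (v+1)) := by
  have h := (Real.hasSum_log_one_add_inv hv).mul_left (v + 1/2)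
  set w : ℝ := 1 / (2 * v + 1) with hw
  have hw0 : 0 < w := by positivity
  have hw1 : w < 1 := by rw [hw, div_lt_one (by positivity)]; linarith
  have hw2 : w ^ 2 < 1 := by nlinarith
  have hg := ((hasSum_geometric_of_lt_one (by positivity) hw2).mul_left (1/3 : ℝ)).add
    (hasSum_ite_eq (0 : ℕ) (2/3 : ℝ))
  have hvw : v + 1/2 = 1 / (2 * w) := by rw [hw]; field_simp
  have hle := hasSum_le (fun k => ?_) h hg
  · have e : 1 / 3 * (1 - w ^ 2)⁻¹ + 2 / 3 = 1 + 1/(12 * v * (v+1)) := by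
      have : 1 - w ^ 2 = 4 * v * (v + 1) / (2 * v + 1)^2 := by rw [hw]; field_simp; ring
      rw [this]; field_simp; ring
    rw [e] at hle
    simpa using hle
  · rw [hvw]
    have e : 1 / (2 * w) * (2 * (1 / (2 * (k:ℝ) + 1)) * w ^ (2 * k + 1))
        = (w ^ 2) ^ k / (2 * k + 1) := by
      rw [pow_succ, pow_mul]; field_simp
    rw [e]
    rcases Nat.eq_zero_or_pos k with rfl | hk
    · norm_num
    · have hk' : (1:ℝ) ≤ k := by exact_mod_cast hk
      rw [if_neg (by omega), add_zero, div_le_iff₀ (by positivity)]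
      have : 0 ≤ (w^2)^k := by positivity
      nlinarith

lemma stir_low (v : ℝ) (hv : 0 < v) :
    1 ≤ (v + 1/2) * Real.log (1 + 1/v) := by
  have h := Real.le_log_one_add_of_nonneg (x := 1/v) (by positivity)
  calc (1:ℝ) = (v + 1/2) * (2 * (1/v) / (1/v + 2)) := by field_simp; ring
    _ ≤ _ := by gcongr

noncomputable def gg (x : ℝ) (a : ℕ) : ℝ := ∏ i ∈ Finset.range a, (1 - ((i:ℝ)+1)/x)

lemma gg_succ (x : ℝ) (a : ℕ) : gg x (a+1) = gg x a * (1 - ((a:ℝ)+1)/x) := by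
  simp [gg, Finset.prod_range_succ]

lemma gg_pos (x : ℝ) (a : ℕ) (h : (a:ℝ) < x) : 0 < gg x a := by
  apply Finset.prod_pos
  intro i hi
  have : ((i:ℝ)+1) ≤ a := by exact_mod_cast Finset.mem_range.1 hi
  have : (0:ℝ) ≤ i := by positivity
  rw [sub_pos, div_lt_one (by linarith)]; linarith

lemma log_step (v : ℝ) (hv : 0 < v) : Real.log (1 + 1/v) = Real.log (v+1) - Real.log v := by
  rw [← Real.log_div (by positivity) (by positivity)]; congr 1; field_simp

lemma gg_up (x : ℝ) (a : ℕ) (h : (a:ℝ) < x) :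
    Real.log (gg x a) ≤ -a - (x - a - 1/2) * Real.log (1 - a/x) := by
  induction a with
  | zero => simp [gg]
  | succ a ih =>
    push_cast at h ⊢
    have ha : (0:ℝ) ≤ a := by positivity
    have hx : 0 < x := by linarith
    have ih := ih (by linarith)
    have hv : 0 < x - (a+1) := by linarith
    have e1 : 1 - ((a:ℝ)+1)/x = (x - (a+1))/x := by field_simp
    have e2 : 1 - (a:ℝ)/x = (x - (a+1) + 1)/x := by field_simp; ring
    have s := stir_low _ hv
    rw [log_step _ hv] at s
    rw [gg_succ, Real.log_mul (gg_pos x a (by linarith)).ne' (by rw [e1]; positivity)]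
    rw [e2, Real.log_div (by positivity) hx.ne'] at ih
    rw [e1, Real.log_div hv.ne' hx.ne']
    linarith

lemma gg_low (x : ℝ) (a : ℕ) (h : (a:ℝ) < x) :
    -a - (x - a - 1/2) * Real.log (1 - a/x) - (1/12) * (1/(x-a) - 1/x) ≤ Real.log (gg x a) := by
  induction a with
  | zero => simp [gg]
  | succ a ih =>
    push_cast at h ⊢
    have ha : (0:ℝ) ≤ a := by positivity
    have hx : 0 < x := by linarith
    have ih := ih (by linarith)
    have hv : 0 < x - (a+1) := by linarith
    have e1 : 1 - ((a:ℝ)+1)/x = (x - (a+1))/x := by field_simp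
    have e2 : 1 - (a:ℝ)/x = (x - (a+1) + 1)/x := by field_simp; ring
    have s := stir_up _ hv
    have e3 : 1/(12 * (x - (a+1)) * (x - (a+1) + 1))
        = (1/12) * (1/(x - (a+1)) - 1/(x-a)) := by
      have : x - (a:ℝ) = x - (a+1) + 1 := by ring
      rw [this]; field_simp; ring
    rw [log_step _ hv, e3] at s
    rw [gg_succ, Real.log_mul (gg_pos x a (by linarith)).ne' (by rw [e1]; positivity)]
    rw [e2, Real.log_div (by positivity) hx.ne'] at ih
    rw [e1, Real.log_div hv.ne' hx.ne']
    linarith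

/-- one-sided contribution -/
lemma side (θ p a L : ℝ) (hθ : 0 < θ) (hθ' : θ ≤ 1/2) (hp : 0 < p) (hp1 : p ≤ θ) (ha : 1 ≤ a)
    (hL : L * θ = a + p) :
    p - θ / (2 * (1-θ)) * (p * (1-p) / (a+p)) ≤
      (L - a - 1/2) * (Real.log (1 - a/L) - Real.log (1-θ)) := by
  have hap : 0 < a + p := by linarith
  have hΘ : 0 < 1 - θ := by linarith
  have hLe : L = (a+p)/θ := by field_simp; linarith
  have hL0 : 0 < L := by rw [hLe]; positivity
  set y := θ * p / ((1-θ) * (a+p)) with hy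
  have hy0 : 0 < y := by positivity
  have hA : 1 - a / L = (1-θ) * (1+y) := by
    rw [hLe, hy]; field_simp; ring
  have hc : L - a = (1-θ)*(1+y) * L := by rw [← hA]; field_simp
  have hyL : (1-θ) * L * y = p := by rw [hLe, hy]; field_simp
  rw [hA, Real.log_mul hΘ.ne' (by positivity)]
  have hlog := Real.le_log_one_add_of_nonneg hy0.le
  have hpos : 0 ≤ L - a - 1/2 := by
    have : 2 * a < L := by
      rw [hLe, lt_div_iff₀ hθ]; nlinarith
    linarith
  calc p - θ / (2 * (1-θ)) * (p * (1-p) / (a+p)) = p - (1-p) * y / 2 := by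
        rw [hy]; field_simp
    _ ≤ p - (1-p) * y / (y+2) := by
        have : (1-p) * y / (y+2) ≤ (1-p)*y/2 := by
          apply div_le_div_of_nonneg_left _ (by norm_num) (by linarith)
          apply mul_nonneg <;> linarith
        linarith
    _ = (L - a - 1/2) * (2 * y / (y+2)) := by
        rw [hc]; field_simp
        linear_combination (-2*(1+y)) * hyL
    _ ≤ (L - a - 1/2) * Real.log (1+y) := by gcongr
    _ = _ := by ring

lemma fin_ineq (θ p q a b : ℝ) (hθ : 0 < θ) (hp : 0 < p) (hq : 0 < q) (hpq : p + q = θ)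
    (ha : 1 ≤ a) (hb : 1 ≤ b)
    (hc : (θ ≤ 1/2 ∧ 3 ≤ a + b ∧ (2 ≤ a ∨ 2 ≤ b)) ∨ (θ ≤ 2/5 ∧ 2 ≤ a+b)) :
    θ^2 / (12 * (a+b) * (1-θ)) + θ / (2 * (1-θ)) * (p * (1-p) / (a+p))
      + θ / (2 * (1-θ)) * (q * (1-q) / (b+q)) ≤ θ + 1/2 * Real.log (1-θ) := by
  have hθ2 : θ ≤ 1/2 := by rcases hc with h | h <;> linarith
  have hΘ : 0 < 1 - θ := by linarith
  have hlog : -Real.log (1-θ) ≤ 2*θ/(2-θ) * (1 + θ^2/(12*(1-θ))) := by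
    have := stir_up ((1-θ)/θ) (by positivity)
    have e : 1 + 1/((1-θ)/θ) = (1-θ)⁻¹ := by field_simp; ring
    rw [e, Real.log_inv] at this
    have h2 : 0 < 2 - θ := by linarith
    have e2 : (1-θ)/θ + 1/2 = (2-θ)/(2*θ) := by field_simp; ring
    have e3 : 1/(12 * ((1-θ)/θ) * ((1-θ)/θ + 1)) = θ^2/(12*(1-θ)) := by field_simp; ring
    rw [e2, e3] at this
    calc -Real.log (1-θ) = 2*θ/(2-θ) * ((2-θ)/(2*θ) * -Real.log (1-θ)) := by field_simp
      _ ≤ _ := by gcongr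
  have one : ∀ x c : ℝ, 0 < x → x ≤ 1/2 → 1 ≤ c → x * (1-x)/(c+x) ≤ 2/25 + 3/10 * x := by
    intro x c hx hx1 hc
    rw [div_le_iff₀ (by linarith)]
    nlinarith [sq_nonneg (x - 31/130), mul_nonneg (by linarith : (0:ℝ) ≤ c - 1) hx.le]
  have two : ∀ x c : ℝ, 0 < x → x ≤ 1/2 → 2 ≤ c → x * (1-x)/(c+x) ≤ 1/50 + 3/10 * x := by
    intro x c hx hx1 hc
    rw [div_le_iff₀ (by linarith)]
    nlinarith [sq_nonneg (x - 19/130), mul_nonneg (by linarith : (0:ℝ) ≤ c - 2) hx.le]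
  have key : ∃ s B : ℝ, 0 < s ∧ s ≤ a + b ∧ p * (1-p) / (a+p) + q * (1-q) / (b+q) ≤ B ∧
      θ/(12*s) + B/2 ≤ (1-θ) - (1-θ+θ^2/12)/(2-θ) := by
    rcases hc with ⟨h1, h3, h⟩ | ⟨h1, h2⟩
    · refine ⟨3, 1/10 + 3/10*θ, by norm_num, h3, ?_, ?_⟩
      · rcases h with h | h
        · linarith [two p a hp (by linarith) h, one q b hq (by linarith) hb]
        · linarith [one p a hp (by linarith) ha, two q b hq (by linarith) h]
      · rw [le_sub_iff_add_le, ← le_sub_iff_add_le', div_le_iff₀ (by linarith)]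
        nlinarith
    · refine ⟨2, 4/25 + 3/10*θ, by norm_num, h2, ?_, ?_⟩
      · linarith [one p a hp (by linarith) ha, one q b hq (by linarith) hb]
      · rw [le_sub_iff_add_le, ← le_sub_iff_add_le', div_le_iff₀ (by linarith)]
        nlinarith
  obtain ⟨s, B, hs, hsab, hB, hfin⟩ := key
  have h2 : 0 < 2 - θ := by linarith
  calc θ^2 / (12 * (a+b) * (1-θ)) + θ / (2 * (1-θ)) * (p * (1-p) / (a+p))
      + θ / (2 * (1-θ)) * (q * (1-q) / (b+q))
      = θ^2 / (12 * (a+b) * (1-θ)) + θ / (2 * (1-θ)) * (p * (1-p) / (a+p)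
      + q * (1-q) / (b+q)) := by ring
    _ ≤ θ^2 / (12 * s * (1-θ)) + θ / (2 * (1-θ)) * B := by gcongr
    _ = θ/(1-θ) * (θ/(12*s) + B/2) := by field_simp
    _ ≤ θ/(1-θ) * ((1-θ) - (1-θ+θ^2/12)/(2-θ)) := by gcongr
    _ = θ - 1/2 * (2*θ/(2-θ) * (1 + θ^2/(12*(1-θ)))) := by field_simp
    _ ≤ _ := by linarith

lemma bad_case (L M : ℝ) (a b : ℕ) (ha : 1 ≤ a) (hb : 1 ≤ b)
    (hK : 2 * ((a:ℝ)+b) + 1 ≤ L + M - 1)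
    (h1 : (a:ℝ) * (L+M-1) < (a+b) * L) (h2 : (b:ℝ) * (L+M-1) < (a+b) * M) :
    gg L a * gg M b ≤ gg (L+M-1) (a+b) := by
  have ha' : (1:ℝ) ≤ a := by exact_mod_cast ha
  have hb' : (1:ℝ) ≤ b := by exact_mod_cast hb
  set K := L + M - 1 with hKd
  have hK0 : 0 < K := by linarith
  have hs : (0:ℝ) < a + b := by linarith
  set θ := ((a:ℝ)+b)/K with hθ
  have hθ0 : 0 < θ := by positivity
  have hθ2 : θ ≤ 1/2 := by rw [hθ, div_le_iff₀ hK0]; linarith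
  have hθK : θ * K = a + b := by rw [hθ]; field_simp
  have hp : 0 < L * θ - a := by
    have : L * θ - a = ((a+b) * L - a * K)/K := by rw [hθ]; field_simp
    rw [this]; apply div_pos _ hK0; linarith
  have hq : 0 < M * θ - b := by
    have : M * θ - b = ((a+b) * M - b * K)/K := by rw [hθ]; field_simp
    rw [this]; apply div_pos _ hK0; linarith
  have hpq : (L * θ - a) + (M * θ - b) = θ := by
    rw [hKd] at hθK; linarith
  have s1 := side θ _ a L hθ0 hθ2 hp (by linarith) ha' (by ring)
  have s2 := side θ _ b M hθ0 hθ2 hq (by linarith) hb' (by ring)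
  have fi := fin_ineq θ _ _ a b hθ0 hp hq hpq ha' hb' (by
    by_cases h : a + b = 2
    · right
      have h' : (a:ℝ) + b = 2 := by exact_mod_cast h
      refine ⟨?_, h'.ge⟩
      rw [hθ, div_le_iff₀ hK0]; linarith
    · left
      refine ⟨hθ2, by exact_mod_cast (by omega : 3 ≤ a + b), ?_⟩
      rcases (by omega : 2 ≤ a ∨ 2 ≤ b) with h | h
      · left; exact_mod_cast h
      · right; exact_mod_cast h)
  have haL : (a:ℝ) < L := by nlinarith
  have hbM : (b:ℝ) < M := by nlinarith
  have habK : ((a+b:ℕ):ℝ) < K := by push_cast; linarith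
  have u1 := gg_up L a haL
  have u2 := gg_up M b hbM
  have l := gg_low K (a+b) habK
  push_cast at l
  rw [← hθ] at l
  have hE : (1/12) * (1/(K - ((a:ℝ)+b)) - 1/K) = θ^2 / (12 * (a+b) * (1-θ)) := by
    rw [← hθK]
    have : 0 < 1 - θ := by linarith
    have e : K - θ * K = K * (1-θ) := by ring
    rw [e]; field_simp; ring
  rw [hE] at l
  have g1 := gg_pos L a haL
  have g2 := gg_pos M b hbM
  rw [← Real.log_le_log_iff (by positivity) (gg_pos _ _ habK), Real.log_mul g1.ne' g2.ne']
  have hKs : K = L + M - 1 := hKd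
  rw [hKs] at l
  linarith

lemma gg_mono (x y : ℝ) (a : ℕ) (h : (a:ℝ) < x) (hxy : x ≤ y) : gg x a ≤ gg y a := by
  apply Finset.prod_le_prod
  · intro i hi
    have : ((i:ℝ)+1) ≤ a := by exact_mod_cast Finset.mem_range.1 hi
    have : (0:ℝ) ≤ i := by positivity
    rw [sub_nonneg, div_le_one (by linarith)]; linarith
  · intro i hi
    have : ((i:ℝ)+1) ≤ a := by exact_mod_cast Finset.mem_range.1 hi
    have : (0:ℝ) ≤ i := by positivity
    have : 0 < x := by linarith
    gcongr

lemma core (s : ℕ) : ∀ (L M : ℝ) (a b : ℕ), a + b = s → 1 ≤ L → 1 ≤ M → (a:ℝ) < L → (b:ℝ) < M →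
    2 * ((a:ℝ)+b) + 2 ≤ L + M → gg L a * gg M b ≤ gg (L+M-1) (a+b) := by
  induction s with
  | zero =>
    intro L M a b hs _ _ _ _ _
    obtain ⟨rfl, rfl⟩ : a = 0 ∧ b = 0 := by omega
    simp [gg]
  | succ s ih =>
    intro L M a b hs hL hM ha hb hK
    rcases a with _ | a
    · simpa [gg] using gg_mono M (L+M-1) b hb (by linarith)
    rcases b with _ | b
    · simpa [gg] using gg_mono L (L+M-1) (a+1) ha (by linarith)
    push_cast at ha hb hK
    have hK0 : 0 < L + M - 1 := by
      have : (0:ℝ) ≤ a := by positivity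
      have : (0:ℝ) ≤ b := by positivity
      linarith
    have a0 : (0:ℝ) ≤ a := by positivity
    have b0 : (0:ℝ) ≤ b := by positivity
    by_cases h1 : ((a:ℝ)+1) * (L+M-1) < ((a+1)+(b+1)) * L
    · by_cases h2 : ((b:ℝ)+1) * (L+M-1) < ((a+1)+(b+1)) * M
      · apply bad_case L M (a+1) (b+1) (by omega) (by omega) <;> push_cast <;> linarith
      · have := ih L M (a+1) b (by omega) hL hM (by push_cast; linarith) (by linarith)
          (by push_cast; linarith)
        rw [show a + 1 + (b+1) = (a+1+b)+1 by ring, gg_succ M, gg_succ (L+M-1), ← mul_assoc]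
        apply mul_le_mul this _ _ (gg_pos _ _ (by push_cast; linarith)).le
        · push_cast
          have : ((a:ℝ)+1+b+1)/(L+M-1) ≤ (b+1)/M := by
            rw [div_le_div_iff₀ hK0 (by linarith)]; linarith
          linarith
        · rw [sub_nonneg, div_le_one (by linarith)]; linarith
    · have := ih L M a (b+1) (by omega) hL hM (by linarith) (by push_cast; linarith)
        (by push_cast; linarith)
      rw [show a + 1 + (b+1) = (a+(b+1))+1 by ring, gg_succ L, gg_succ (L+M-1), mul_right_comm]
      apply mul_le_mul this _ _ (gg_pos _ _ (by push_cast; linarith)).le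
      · push_cast
        have : ((a:ℝ)+(b+1)+1)/(L+M-1) ≤ (a+1)/L := by
          rw [div_le_div_iff₀ hK0 (by linarith)]; linarith
        linarith
      · rw [sub_nonneg, div_le_one (by linarith)]; linarith

noncomputable def ff (x : ℝ) (k : ℕ) : ℝ := ∏ i ∈ Finset.range k, (1 - (i:ℝ)/x)

lemma ff_succ (x : ℝ) (k : ℕ) : ff x (k+1) = gg x k := by
  simp [ff, gg, Finset.prod_range_succ']

lemma ff_zero (x : ℝ) : ff x 0 = 1 := by simp [ff]

lemma gg_le_one (x : ℝ) (a : ℕ) (h : (a:ℝ) < x) : gg x a ≤ 1 := by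
  apply Finset.prod_le_one
  · intro i hi
    have : ((i:ℝ)+1) ≤ a := by exact_mod_cast Finset.mem_range.1 hi
    have : (0:ℝ) ≤ i := by positivity
    rw [sub_nonneg, div_le_one (by linarith)]; linarith
  · intro i hi
    have : ((i:ℝ)+1) ≤ a := by exact_mod_cast Finset.mem_range.1 hi
    have : (0:ℝ) ≤ i := by positivity
    have : 0 < x := by linarith
    have : 0 ≤ ((i:ℝ)+1)/x := by positivity
    linarith

lemma desc_eq (L k : ℕ) : (L.descFactorial k : ℝ) = (L:ℝ)^k * ff L k := by
  induction k with
  | zero => simp [ff]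
  | succ k ih =>
    rw [Nat.descFactorial_succ, ff, Finset.prod_range_succ, ← ff, pow_succ]
    push_cast
    rw [ih]
    rcases Nat.eq_zero_or_pos L with rfl | hL
    · simp
    have hL' : (0:ℝ) < L := by exact_mod_cast hL
    rcases le_or_gt k L with h | h
    · rw [Nat.cast_sub h]; field_simp
    · have : ff (L:ℝ) k = 0 := by
        have := ih
        rw [Nat.descFactorial_eq_zero_iff_lt.2 h] at this
        simpa [hL'.ne', hL.ne'] using this.symm
      rw [this]; simp

/-- shift identity -/
lemma shift (x : ℝ) (hx : 1 < x) (n : ℕ) : gg x n = (1 - 1/x)^n * ff (x-1) n := by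
  have h1 : 0 < x - 1 := by linarith
  have h0 : 0 < x := by linarith
  rw [gg, ff, ← Finset.card_range n, ← Finset.prod_const, Finset.card_range,
    ← Finset.prod_mul_distrib]
  apply Finset.prod_congr rfl
  intro i _
  field_simp
  ring

lemma edge (L M n : ℕ) (hn : 1 ≤ n) (hnM : n + 1 ≤ M) :
    ff M (n+1) ≤ ff ((L:ℝ)+M-1) n := by
  obtain ⟨n, rfl⟩ : ∃ m, n = m + 1 := ⟨n - 1, by omega⟩
  have hM : ((n:ℝ)+1+1) ≤ M := by exact_mod_cast hnM
  have n0 : (0:ℝ) ≤ n := by positivity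
  rcases Nat.eq_zero_or_pos L with rfl | hL
  · rw [ff_succ, shift _ (by linarith)]
    have hp : 0 < ff ((M:ℝ)-1) (n+1) := by
      rw [ff_succ]; apply gg_pos; linarith
    have : (1 - 1/(M:ℝ))^(n+1) ≤ 1 := by
      have h1 : 1/(M:ℝ) ≤ 1 := by rw [div_le_one (by linarith)]; linarith
      have h2 : 0 ≤ 1/(M:ℝ) := by positivity
      apply pow_le_one₀ <;> linarith
    simp only [Nat.cast_zero, zero_add]
    nlinarith
  · have hL' : (1:ℝ) ≤ L := by exact_mod_cast hL
    rw [ff_succ, ff_succ, gg_succ]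
    have g := gg_pos (M:ℝ) n (by linarith)
    have m := gg_mono (M:ℝ) (L+M-1) n (by linarith) (by linarith)
    have : 0 ≤ ((n+1:ℕ):ℝ)/M := by positivity
    push_cast at this
    have := gg_succ (M:ℝ) n
    nlinarith

lemma keyff (L M k m : ℕ) (h2 : 2 ≤ k + m) (hk : k ≤ L) (hm : m ≤ M)
    (hh : 2 * (k + m) ≤ L + M + 2) :
    ff L k * ff M m ≤ ff ((L:ℝ)+M-1) (k+m-1) := by
  rcases k with _ | a
  · obtain ⟨n, rfl⟩ : ∃ n, m = n + 1 := ⟨m - 1, by omega⟩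
    rw [ff_zero, one_mul]
    simpa using edge L M n (by omega) hm
  rcases m with _ | b
  · rw [ff_zero, mul_one]
    have := edge M L a (by omega) hk
    rw [add_comm (M:ℝ)] at this
    simpa using this
  rw [show a + 1 + (b+1) - 1 = (a+b)+1 by omega, ff_succ, ff_succ, ff_succ]
  have h1 : ((a:ℝ)+1) ≤ L := by exact_mod_cast hk
  have h3 : ((b:ℝ)+1) ≤ M := by exact_mod_cast hm
  have h4 : 2 * (((a:ℝ)+1) + (b+1)) ≤ L + M + 2 := by exact_mod_cast hh
  have a0 : (0:ℝ) ≤ a := by positivity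
  have b0 : (0:ℝ) ≤ b := by positivity
  apply core (a+b) L M a b rfl <;> linarith

lemma part1 (N L n : ℕ) (hn : 1 ≤ n) (hnN : n ≤ N)
    (hhalf : (n : ℝ) - 1 ≤ (N : ℝ) / 2) (hL : L ≤ N) (k : ℕ) (hk : k ≤ n) :
    hypPMF N L n k ≤ (1 - 1 / (N : ℝ)) ^ (-((n : ℤ) - 1)) * binPMF n ((L : ℝ) / N) k := by
  obtain ⟨M, rfl⟩ := Nat.exists_eq_add_of_le hL
  obtain ⟨m, rfl⟩ := Nat.exists_eq_add_of_le hk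
  have hN1 : (1:ℝ) ≤ ((L + M : ℕ):ℝ) := by exact_mod_cast hn.trans hnN
  have hc0 : 0 ≤ 1 - 1/((L+M:ℕ):ℝ) := by
    rw [sub_nonneg, div_le_one (by linarith)]; exact hN1
  have hz : (1 - 1 / ((L+M:ℕ) : ℝ)) ^ (-(((k+m:ℕ) : ℤ) - 1))
      = ((1 - 1 / ((L+M:ℕ) : ℝ)) ^ (k+m-1))⁻¹ := by
    rw [zpow_neg, ← zpow_natCast, Nat.cast_sub hn]; simp
  rw [hz]
  unfold hypPMF binPMF
  rw [Nat.add_sub_cancel_left, Nat.add_sub_cancel_left]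
  have hp : 1 - (L:ℝ)/((L+M:ℕ):ℝ) = M / ((L+M:ℕ):ℝ) := by
    rw [eq_div_iff (by linarith), sub_mul, div_mul_cancel₀ _ (by linarith)]; push_cast; ring
  rw [hp]
  by_cases hkL : L < k
  · rw [Nat.choose_eq_zero_of_lt hkL]
    simp only [Nat.cast_zero, zero_mul, zero_div]
    positivity
  by_cases hmM : M < m
  · rw [Nat.choose_eq_zero_of_lt hmM]
    simp only [Nat.cast_zero, mul_zero, zero_div]
    positivity
  push Not at hkL hmM
  have hNn : ((k+m:ℕ):ℝ) ≤ ((L+M:ℕ):ℝ) := by exact_mod_cast hnN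
  obtain ⟨s, hs⟩ : ∃ s, k + m = s + 1 := ⟨k+m-1, by omega⟩
  have hsN : (s:ℝ) < ((L+M:ℕ):ℝ) := by exact_mod_cast (by omega : s < L + M)
  have hfN : 0 < ff ((L+M:ℕ):ℝ) (k+m) := by rw [hs, ff_succ]; exact gg_pos _ _ hsN
  have hfle : ff L k * ff M m ≤ ((1 - 1 / ((L+M:ℕ) : ℝ)) ^ (k+m-1))⁻¹ * ff ((L+M:ℕ):ℝ) (k+m) := by
    rcases Nat.eq_zero_or_pos s with rfl | hs0
    · rw [hs]
      rcases (by omega : (k = 0 ∧ m = 1) ∨ (k = 1 ∧ m = 0)) with ⟨rfl, rfl⟩ | ⟨rfl, rfl⟩ <;>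
        simp [ff]
    · have hN2 : (1:ℝ) < ((L+M:ℕ):ℝ) := by exact_mod_cast (by omega : 1 < L + M)
      have hc : 0 < 1 - 1/((L+M:ℕ):ℝ) := by
        rw [sub_pos, div_lt_one (by linarith)]; exact hN2
      have hh : 2 * (k+m) ≤ L + M + 2 := by
        have : 2 * (((k+m:ℕ)):ℝ) ≤ ((L+M:ℕ):ℝ) + 2 := by linarith
        exact_mod_cast this
      have := keyff L M k m (by omega) hkL hmM hh
      rw [hs, ff_succ, shift _ hN2, Nat.add_sub_cancel, ← mul_assoc,
        inv_mul_cancel₀ (by positivity), one_mul]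
      rw [hs, Nat.add_sub_cancel] at this
      push_cast
      exact this
  have cL : (L.choose k : ℝ) = (L:ℝ)^k * ff L k / k.factorial := by
    rw [← desc_eq, Nat.descFactorial_eq_factorial_mul_choose]; push_cast; field_simp
  have cM : (M.choose m : ℝ) = (M:ℝ)^m * ff M m / m.factorial := by
    rw [← desc_eq, Nat.descFactorial_eq_factorial_mul_choose]; push_cast; field_simp
  have cN : ((L+M).choose (k+m) : ℝ)
      = ((L+M:ℕ):ℝ)^(k+m) * ff ((L+M:ℕ):ℝ) (k+m) / (k+m).factorial := by
    rw [← desc_eq, Nat.descFactorial_eq_factorial_mul_choose]; push_cast; field_simp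
  have cn : ((k+m).choose k : ℝ) = (k+m).factorial / (k.factorial * m.factorial) := by
    rw [Nat.cast_add_choose]
  rw [cL, cM, cN, cn]
  generalize ((1 - 1 / ((L+M:ℕ) : ℝ)) ^ (k+m-1))⁻¹ = C at hfle
  generalize ff ((L+M:ℕ):ℝ) (k+m) = F at *
  generalize ((L+M:ℕ):ℝ) = X at *
  have hX : 0 < X := by linarith
  calc _ = (((k+m).factorial:ℝ) / (k.factorial * m.factorial) * (L/X)^k * (M/X)^m) *
        ((ff L k * ff M m) / F) := by
        rw [div_pow, div_pow, pow_add]; field_simp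
    _ ≤ (((k+m).factorial:ℝ) / (k.factorial * m.factorial) * (L/X)^k * (M/X)^m) * C := by
        apply mul_le_mul_of_nonneg_left _ (by positivity)
        rw [div_le_iff₀ hfN]; exact hfle
    _ = _ := by ring

theorem hyp_bin_ratio_bound (N L n : ℕ) (hn : 1 ≤ n) (hnN : n ≤ N)
    (hhalf : (n : ℝ) - 1 ≤ (N : ℝ) / 2) (hL : L ≤ N) :
    (∀ k ≤ n, hypPMF N L n k ≤
        (1 - 1 / (N : ℝ)) ^ (-((n : ℤ) - 1)) * binPMF n ((L : ℝ) / N) k) ∧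
    IsGreatest {r : ℝ | ∃ k ≤ n, r = hypPMF N 1 n k / binPMF n (1 / (N : ℝ)) k}
      ((1 - 1 / (N : ℝ)) ^ (-((n : ℤ) - 1))) ∧
    (1 - 1 / (N : ℝ)) ^ (-((n : ℤ) - 1)) ≤ (1 - ((n : ℝ) - 1) / N)⁻¹ := by
  have hN1 : (1:ℝ) ≤ N := by exact_mod_cast hn.trans hnN
  have hc0 : 0 ≤ 1 - 1/(N:ℝ) := by
    rw [sub_nonneg, div_le_one (by linarith)]; exact hN1
  have hz : (1 - 1 / (N : ℝ)) ^ (-((n : ℤ) - 1)) = ((1 - 1 / (N : ℝ)) ^ (n-1))⁻¹ := by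
    rw [zpow_neg, ← zpow_natCast, Nat.cast_sub hn]; simp
  refine ⟨fun k hk => part1 N L n hn hnN hhalf hL k hk, ⟨⟨1, hn, ?_⟩, ?_⟩, ?_⟩
  · rw [hz]
    unfold hypPMF binPMF
    obtain ⟨s, rfl⟩ : ∃ s, n = s + 1 := ⟨n-1, by omega⟩
    obtain ⟨K, rfl⟩ : ∃ K, N = K + 1 := ⟨N-1, by omega⟩
    have hch : ((K:ℝ)+1) * (K.choose s) = ((K+1).choose (s+1)) * ((s:ℝ)+1) := by
      exact_mod_cast Nat.add_one_mul_choose_eq K s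
    have hpos : (0:ℝ) < (K+1).choose (s+1) := by exact_mod_cast Nat.choose_pos hnN
    have hK : (0:ℝ) < (K:ℝ)+1 := by positivity
    have hs : (0:ℝ) < (s:ℝ)+1 := by positivity
    have hr : (K.choose s : ℝ) / ((K+1).choose (s+1)) = (s+1) * (1/(K+1)) := by
      field_simp; linarith
    simp only [Nat.add_sub_cancel, Nat.choose_one_right, Nat.cast_add, Nat.cast_one, pow_one,
      one_mul]
    rw [hr, inv_eq_one_div]
    rw [div_mul_eq_div_div, div_self (by positivity)]
  · rintro r ⟨k, hk, rfl⟩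
    have := part1 N 1 n hn hnN hhalf (hn.trans hnN) k hk
    rw [Nat.cast_one] at this
    have hb : 0 ≤ binPMF n (1/(N:ℝ)) k := by unfold binPMF; positivity
    have hC : 0 ≤ (1 - 1 / (N : ℝ)) ^ (-((n : ℤ) - 1)) := zpow_nonneg hc0 _
    exact div_le_of_le_mul₀ hb hC this
  · rw [hz]
    have hN0 : (0:ℝ) < N := by linarith
    apply inv_anti₀
    · rw [sub_pos, div_lt_one hN0]; linarith
    · have := one_add_mul_le_pow (a := -(1/(N:ℝ))) (by linarith) (n-1)
      rw [Nat.cast_sub hn] at this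
      rw [sub_eq_add_neg 1 (1/(N:ℝ))]
      refine le_trans (le_of_eq ?_) this
      push_cast; ring
end

section
/- For every integer n ≥ 1, every p ∈ (0,1), and every k ∈ ℕ, one has Bin(n,p)({k}) < (1 − p)^{−1} · Poiss(np)({k}); equivalently, log ρ(Bin(n,p), Poiss(np)) < −log(1 − p). -/
/-- pmf of the Poisson distribution with parameter `λ`. -/
noncomputable def poissonPMF (lam : ℝ) (k : ℕ) : ℝ :=
  Real.exp (-lam) * lam ^ k / (Nat.factorial k : ℝ)

lemma aux_step (n : ℕ) : Real.exp 1 * (n : ℝ) ^ (n + 1) < ((n : ℝ) + 1) ^ (n + 1) := by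
  have hn : (0 : ℝ) < (n : ℝ) + 1 := by positivity
  have h1 : -(1 / ((n : ℝ) + 1)) + 1 < Real.exp (-(1 / ((n : ℝ) + 1))) :=
    Real.add_one_lt_exp (by have : 0 < 1 / ((n : ℝ) + 1) := by positivity
                            linarith)
  have h2 : (n : ℝ) < ((n : ℝ) + 1) * Real.exp (-(1 / ((n : ℝ) + 1))) := by
    have := mul_lt_mul_of_pos_left h1 hn
    have e : ((n : ℝ) + 1) * (-(1 / ((n : ℝ) + 1)) + 1) = n := by field_simp; ring
    rwa [e] at this
  have h3 := pow_lt_pow_left₀ h2 (Nat.cast_nonneg n) (Nat.succ_ne_zero n)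
  rw [Nat.succ_eq_add_one, mul_pow, ← Real.exp_nat_mul] at h3
  have e : ((n + 1 : ℕ) : ℝ) * (-(1 / ((n : ℝ) + 1))) = -1 := by push_cast; field_simp
  rw [e] at h3
  calc _ < Real.exp 1 * (((n : ℝ) + 1) ^ (n + 1) * Real.exp (-1)) :=
        mul_lt_mul_of_pos_left h3 (Real.exp_pos _)
    _ = ((n : ℝ) + 1) ^ (n + 1) * (Real.exp 1 * Real.exp (-1)) := by ring
    _ = _ := by rw [← Real.exp_add]; simp

/-- The sequence `n! eⁿ / n^(n+1)`. -/
noncomputable def auxA (n : ℕ) : ℝ :=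
  (n.factorial : ℝ) * Real.exp n / (n : ℝ) ^ (n + 1)

lemma auxA_step (n : ℕ) (hn : 1 ≤ n) : auxA (n + 1) < auxA n := by
  have h := aux_step n
  have h0 : (0 : ℝ) < n := by exact_mod_cast hn
  unfold auxA
  rw [div_lt_div_iff₀ (by positivity) (by positivity), Nat.factorial_succ]
  push_cast
  rw [Real.exp_add]
  have hpos : 0 < ((n : ℝ) + 1) * n.factorial * Real.exp n := by positivity
  have := mul_lt_mul_of_pos_left h hpos
  calc _ = ((n : ℝ) + 1) * n.factorial * Real.exp n * (Real.exp 1 * (n : ℝ) ^ (n + 1)) := by ring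
    _ < _ := this
    _ = _ := by ring

lemma auxA_lt (m : ℕ) (hm : 1 ≤ m) (j : ℕ) : auxA (m + (j + 1)) < auxA m := by
  induction j with
  | zero => exact auxA_step m hm
  | succ j ih => exact (auxA_step (m + (j + 1)) (by omega)).trans ih

lemma aux_core (s j : ℕ) (p : ℝ) (hp0 : 0 < p) (hp1 : p < 1) :
    ((s + 1 + j).factorial : ℝ) * (1 - p) ^ (s + 1) * Real.exp (((s + 1 + j : ℕ) : ℝ) * p)
      < s.factorial * ((s + 1 + j : ℕ) : ℝ) ^ (j + 1) := by
  have hq : 0 < 1 - p := by linarith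
  rcases j with _ | j
  · have h1 : 1 - p < Real.exp (-p) := by
      have := Real.add_one_lt_exp (x := -p) (by linarith)
      linarith
    have h2 := pow_lt_pow_left₀ h1 hq.le (Nat.succ_ne_zero s)
    rw [← Real.exp_nat_mul] at h2
    have h3 : (1 - p) ^ (s + 1) * Real.exp (((s + 1 : ℕ) : ℝ) * p) < 1 := by
      calc _ < Real.exp (((s + 1 : ℕ) : ℝ) * -p) * Real.exp (((s + 1 : ℕ) : ℝ) * p) :=
            mul_lt_mul_of_pos_right h2 (Real.exp_pos _)
        _ = 1 := by rw [← Real.exp_add]; simp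
    have hf : (0 : ℝ) < ((s + 1).factorial : ℝ) := by positivity
    have h4 := mul_lt_mul_of_pos_left h3 hf
    simp only [Nat.add_zero, zero_add, pow_one]
    calc _ = ((s + 1).factorial : ℝ) *
          ((1 - p) ^ (s + 1) * Real.exp (((s + 1 : ℕ) : ℝ) * p)) := by ring
      _ < _ := h4
      _ = _ := by rw [Nat.factorial_succ]; push_cast; ring
  · have hA := auxA_lt (s + 1) (by omega) j
    set n : ℕ := s + 1 + (j + 1) with hn
    set m : ℕ := s + 1 with hm
    have hn0 : (0 : ℝ) < n := by rw [hn]; positivity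
    have hm0 : (0 : ℝ) < m := by rw [hm]; positivity
    have h1 : (1 - p) * n / m ≤ Real.exp ((1 - p) * n / m - 1) := by
      have := Real.add_one_le_exp ((1 - p) * n / m - 1)
      linarith
    have h2 := pow_le_pow_left₀ (by positivity) h1 m
    rw [← Real.exp_nat_mul] at h2
    have e : (m : ℝ) * ((1 - p) * n / m - 1) = n - m - n * p := by field_simp; ring
    rw [e, div_pow, mul_pow, div_le_iff₀ (by positivity), Real.exp_sub, Real.exp_sub] at h2
    unfold auxA at hA
    rw [div_lt_div_iff₀ (by positivity) (by positivity)] at hA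
    have hs : (m.factorial : ℝ) = m * s.factorial := by
      rw [hm, Nat.factorial_succ]; push_cast; ring
    have hpw : (n : ℝ) ^ (n + 1) = n ^ m * (n : ℝ) ^ (j + 1 + 1) := by
      rw [← pow_add]; congr 1
    rw [hs, hpw] at hA
    have hEm := Real.exp_pos (m : ℝ)
    have hEn := Real.exp_pos (n : ℝ)
    have hEp := Real.exp_pos ((n : ℝ) * p)
    have h3 : (1 - p) ^ m * (n : ℝ) ^ m * (Real.exp m * Real.exp (n * p))
        ≤ Real.exp n * (m : ℝ) ^ m := by
      have := mul_le_mul_of_nonneg_right h2 (by positivity : 0 ≤ Real.exp m * Real.exp (n * p))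
      refine this.trans_eq ?_
      field_simp
    have hc : (0 : ℝ) < n ^ m * m * Real.exp m := by positivity
    refine lt_of_mul_lt_mul_left ?_ hc.le
    calc _ = (n.factorial : ℝ) * m *
          ((1 - p) ^ m * (n : ℝ) ^ m * (Real.exp m * Real.exp (n * p))) := by ring
      _ ≤ (n.factorial : ℝ) * m * (Real.exp n * (m : ℝ) ^ m) :=
          mul_le_mul_of_nonneg_left h3 (by positivity)
      _ = (n.factorial : ℝ) * Real.exp n * (m : ℝ) ^ (m + 1) := by ring
      _ < _ := hA
      _ = _ := by ring

/-- For `n ≥ 1` and `p ∈ (0,1)`, `Bin(n,p)({k}) < (1-p)⁻¹ · Poiss(np)({k})` for all `k`;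
i.e. `ρ(Bin(n,p), Poiss(np)) < (1-p)⁻¹`. -/
theorem bin_poisson_ratio_lt (n : ℕ) (hn : 1 ≤ n) (p : ℝ) (hp0 : 0 < p) (hp1 : p < 1) :
    ∀ k : ℕ, binPMF n p k < (1 - p)⁻¹ * poissonPMF ((n : ℝ) * p) k := by
  intro k
  have hq : 0 < 1 - p := by linarith
  have hn0 : (0 : ℝ) < n := by exact_mod_cast hn
  unfold binPMF poissonPMF
  rcases lt_or_ge n k with hk | hk
  · rw [Nat.choose_eq_zero_of_lt hk]
    simp only [Nat.cast_zero, zero_mul]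
    positivity
  have key : (n.factorial : ℝ) * (1 - p) ^ (n - k + 1) * Real.exp ((n : ℝ) * p)
      < (n - k).factorial * (n : ℝ) ^ k := by
    rcases k with _ | j
    · have h1 : 1 - p ≤ Real.exp (-p) := by
        have := Real.add_one_le_exp (-p)
        linarith
      have h2 := pow_le_pow_left₀ hq.le h1 n
      rw [← Real.exp_nat_mul] at h2
      have h3 : (1 - p) ^ n * Real.exp ((n : ℝ) * p) ≤ 1 := by
        calc _ ≤ Real.exp ((n : ℝ) * -p) * Real.exp ((n : ℝ) * p) :=
              mul_le_mul_of_nonneg_right h2 (Real.exp_pos _).le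
          _ = 1 := by rw [← Real.exp_add]; simp
      have h4 : (1 - p) * ((1 - p) ^ n * Real.exp ((n : ℝ) * p)) < 1 := by nlinarith
      have hf : (0 : ℝ) < (n.factorial : ℝ) := by positivity
      have h5 := mul_lt_mul_of_pos_left h4 hf
      simp only [Nat.sub_zero, pow_zero]
      calc _ = (n.factorial : ℝ) * ((1 - p) * ((1 - p) ^ n * Real.exp ((n : ℝ) * p))) := by ring
        _ < _ := h5
    · obtain ⟨s, rfl⟩ : ∃ s, n = s + 1 + j := ⟨n - (j + 1), by omega⟩
      have e : s + 1 + j - (j + 1) = s := by omega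
      rw [e]
      exact aux_core s j p hp0 hp1
  have hch : (n.factorial : ℝ) = n.choose k * k.factorial * (n - k).factorial := by
    exact_mod_cast (Nat.choose_mul_factorial_mul_factorial hk).symm
  have hsf : (0 : ℝ) < ((n - k).factorial : ℝ) := by positivity
  have hkf : (0 : ℝ) < (k.factorial : ℝ) := by positivity
  have hE := Real.exp_pos ((n : ℝ) * p)
  rw [hch] at key
  have key2 : (n.choose k : ℝ) * k.factorial * (1 - p) ^ (n - k + 1) * Real.exp ((n : ℝ) * p)
      < (n : ℝ) ^ k := by
    refine lt_of_mul_lt_mul_left ?_ hsf.le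
    linarith
  have hr : (1 - p)⁻¹ * (Real.exp (-((n : ℝ) * p)) * ((n : ℝ) * p) ^ k / k.factorial)
      = (n : ℝ) ^ k * p ^ k / ((1 - p) * Real.exp ((n : ℝ) * p) * k.factorial) := by
    rw [Real.exp_neg, mul_pow]
    field_simp
  rw [hr, lt_div_iff₀ (by positivity)]
  have := mul_lt_mul_of_pos_right key2 (pow_pos hp0 k)
  calc _ = _ := by ring
    _ < _ := this
end

section
/- Let n ≥ 1 be an integer and p ∈ (0,1) with ⌈np⌉ ≤ n − 1. Then for every k ∈ ℕ, one has Bin(n,p)({k}) < (1 − ⌈np⌉/n)^{−1/2} · Poiss(np)({k}); equivalently, log ρ(Bin(n,p), Poiss(np)) < −log(1 − ⌈np⌉/n)/2. -/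
theorem stirlingSeq_step (j : ℕ) :
    Stirling.stirlingSeq (j + 2) < Stirling.stirlingSeq (j + 1) := by
  have h := Stirling.log_stirlingSeq_sdiff_hasSum j
  have hpos : 0 < Real.log (Stirling.stirlingSeq (j + 1)) -
      Real.log (Stirling.stirlingSeq (j + 2)) := by
    rw [← h.tsum_eq]
    exact h.summable.tsum_pos (fun i => by positivity) 0 (by positivity)
  have h2 : Real.log (Stirling.stirlingSeq (j + 2)) <
      Real.log (Stirling.stirlingSeq (j + 1)) := by linarith
  exact (Real.log_lt_log_iff (Stirling.stirlingSeq'_pos (j + 1))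
    (Stirling.stirlingSeq'_pos j)).1 h2

theorem stirlingSeq_lt {a b : ℕ} (ha : 1 ≤ a) (hab : a < b) :
    Stirling.stirlingSeq b < Stirling.stirlingSeq a := by
  obtain ⟨c, rfl⟩ := Nat.exists_eq_add_of_le' ha
  obtain ⟨d, rfl⟩ := Nat.exists_eq_add_of_le' (ha.trans hab.le)
  exact strictAnti_nat_of_succ_lt (f := fun j => Stirling.stirlingSeq (j + 1))
    stirlingSeq_step (by omega : c < d)

theorem fact_eq_stirling (a : ℕ) (ha : 1 ≤ a) :
    (a.factorial : ℝ) = Stirling.stirlingSeq a * (√2 * √a * (a ^ a / Real.exp a)) := by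
  have : (0 : ℝ) < a := by exact_mod_cast ha
  have h1 : √(2 * (a : ℝ)) = √2 * √a := by rw [Real.sqrt_mul (by norm_num)]
  have h2 : ((a : ℝ) / Real.exp 1) ^ a = a ^ a / Real.exp a := by
    rw [div_pow, ← Real.exp_nat_mul, mul_one]
  rw [Stirling.stirlingSeq, h1, h2]
  field_simp

/-- the ratio of the pmfs, up to the factor `exp (n p)`. -/
noncomputable def ratioAux (n : ℕ) (p : ℝ) (k : ℕ) : ℝ :=
  (n.descFactorial k : ℝ) * (1 - p) ^ (n - k) / (n : ℝ) ^ k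

theorem ratioAux_succ (n k : ℕ) (p : ℝ) (hk : k < n) :
    ratioAux n p (k + 1) * (n * (1 - p)) = ratioAux n p k * (n - k) := by
  have hn : (0 : ℝ) < n := by exact_mod_cast (by omega : 0 < n)
  unfold ratioAux
  rw [Nat.descFactorial_succ, show n - k = n - (k + 1) + 1 by omega, pow_succ, pow_succ]
  rw [← show n - k = n - (k + 1) + 1 by omega]
  push_cast [Nat.cast_sub hk.le]
  field_simp

theorem ratioAux_nonneg (n k : ℕ) (p : ℝ) (hp : p < 1) : 0 ≤ ratioAux n p k := by
  have : 0 ≤ 1 - p := by linarith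
  unfold ratioAux
  positivity

theorem ratioAux_le (n m k : ℕ) (p : ℝ) (hp : p < 1) (hmn : m < n)
    (h1 : (n : ℝ) * p ≤ m) (h2 : (m : ℝ) < n * p + 1) :
    ratioAux n p k ≤ ratioAux n p m := by
  have hn : (0 : ℝ) < n := by exact_mod_cast (by omega : 0 < n)
  have hq : (0 : ℝ) < n * (1 - p) := mul_pos hn (by linarith)
  rcases le_total k m with h | h
  · refine Nat.decreasingInduction' (P := fun k => ratioAux n p k ≤ ratioAux n p m)
      (fun j hj _ ih => ?_) h le_rfl
    refine le_trans ?_ ih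
    have hs := ratioAux_succ n j p (by omega)
    have hj' : (j : ℝ) + 1 ≤ m := by exact_mod_cast hj
    have h0 := ratioAux_nonneg n j p hp
    refine le_of_mul_le_mul_right ?_ hq
    rw [hs]
    exact mul_le_mul_of_nonneg_left (by linarith) h0
  · induction k, h using Nat.le_induction with
    | base => exact le_rfl
    | succ j hj ih =>
      refine le_trans ?_ ih
      have h0 := ratioAux_nonneg n j p hp
      by_cases hjn : j < n
      · have hs := ratioAux_succ n j p hjn
        have hj' : (m : ℝ) ≤ j := by exact_mod_cast hj
        refine le_of_mul_le_mul_right ?_ hq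
        rw [hs]
        exact mul_le_mul_of_nonneg_left (by linarith) h0
      · have : ratioAux n p (j + 1) = 0 := by
          unfold ratioAux
          rw [Nat.descFactorial_of_lt (by omega)]
          simp
        rw [this]; exact h0

theorem ratioAux_exp_lt (m N : ℕ) (p : ℝ) (hm : 1 ≤ m) (hN : 1 ≤ N) (hp : p < 1)
    (h1 : ((m + N : ℕ) : ℝ) * p ≤ m) :
    ratioAux (m + N) p m * Real.exp (((m + N : ℕ) : ℝ) * p) < √((m + N : ℕ) : ℝ) / √(N : ℝ) := by
  set n := m + N with hn
  have hNp : (0 : ℝ) < N := by exact_mod_cast hN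
  have hmp : (0 : ℝ) < m := by exact_mod_cast hm
  have hnc : (n : ℝ) = m + N := by rw [hn]; push_cast; ring
  have hnp : (0 : ℝ) < n := by rw [hnc]; positivity
  have hA : ((n : ℝ) * (1 - p)) ^ N ≤ (N : ℝ) ^ N * Real.exp (m - n * p) := by
    have hb : (n : ℝ) * (1 - p) ≤ N * Real.exp ((m - n * p) / N) := by
      have := Real.add_one_le_exp ((m - n * p) / (N : ℝ))
      calc (n : ℝ) * (1 - p) = N * ((m - n * p) / N + 1) := by
            field_simp
            rw [hnc]; ring
        _ ≤ _ := mul_le_mul_of_nonneg_left this hNp.le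
    calc _ ≤ (N * Real.exp ((m - n * p) / N)) ^ N :=
          pow_le_pow_left₀ (mul_nonneg hnp.le (by linarith)) hb N
      _ = _ := by
          rw [mul_pow, ← Real.exp_nat_mul]
          congr 2
          field_simp
  have hD : (n.descFactorial m : ℝ) * N.factorial = n.factorial := by
    have := Nat.factorial_mul_descFactorial (show m ≤ n by omega)
    rw [show n - m = N by omega] at this
    rw [mul_comm]; exact_mod_cast this
  have hE : ratioAux n p m * Real.exp (n * p) ≤
      n.descFactorial m * N ^ N * Real.exp m / n ^ n := by
    have e1 : ratioAux n p m = n.descFactorial m * ((n : ℝ) * (1 - p)) ^ N / n ^ n := by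
      unfold ratioAux
      rw [show n - m = N by omega, mul_pow]
      have : (n : ℝ) ^ n = n ^ m * n ^ N := by rw [← pow_add]
      rw [this]
      field_simp
    rw [e1, show Real.exp (m : ℝ) = Real.exp (m - n * p) * Real.exp (n * p) by
      rw [← Real.exp_add]; congr 1; ring]
    rw [div_mul_eq_mul_div]
    apply div_le_div_of_nonneg_right _ (by positivity)
    calc _ ≤ n.descFactorial m * ((N : ℝ) ^ N * Real.exp (m - n * p)) * Real.exp (n * p) := by
          gcongr
      _ = _ := by ring
  refine lt_of_le_of_lt hE ?_
  have hs := stirlingSeq_lt hN (show N < n by omega)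
  have hsN : 0 < Stirling.stirlingSeq N := by
    obtain ⟨c, rfl⟩ := Nat.exists_eq_add_of_le' hN
    exact Stirling.stirlingSeq'_pos c
  have hF1 := fact_eq_stirling n (by omega)
  have hF2 := fact_eq_stirling N hN
  have hD' : (n.descFactorial m : ℝ) = n.factorial / N.factorial := by
    rw [← hD]
    field_simp
  have key : n.descFactorial m * N ^ N * Real.exp m / n ^ n =
      Stirling.stirlingSeq n / Stirling.stirlingSeq N * (√(n : ℝ) / √(N : ℝ)) := by
    rw [hD', hF1, hF2, show Real.exp (n : ℝ) = Real.exp m * Real.exp N by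
      rw [← Real.exp_add, hnc]]
    have : √(N : ℝ) ≠ 0 := by positivity
    have : (√2 : ℝ) ≠ 0 := by positivity
    field_simp
  rw [key]
  have : Stirling.stirlingSeq n / Stirling.stirlingSeq N < 1 := by rwa [div_lt_one hsN]
  exact mul_lt_of_lt_one_left (by positivity) this

/-- For `n ≥ 1`, `p ∈ (0,1)` with `⌈np⌉ ≤ n - 1`,
`Bin(n,p)({k}) < (1 - ⌈np⌉/n)^{-1/2} · Poiss(np)({k})` for all `k`;
i.e. `log ρ(Bin(n,p), Poiss(np)) < -log(1 - ⌈np⌉/n)/2`. -/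
theorem bin_poisson_ratio_lt_sqrt (n : ℕ) (hn : 1 ≤ n) (p : ℝ) (hp0 : 0 < p) (hp1 : p < 1)
    (hk : ⌈(n : ℝ) * p⌉₊ ≤ n - 1) :
    ∀ k : ℕ, binPMF n p k <
      (1 - (⌈(n : ℝ) * p⌉₊ : ℝ) / n) ^ (-(1 / 2) : ℝ) * poissonPMF ((n : ℝ) * p) k := by
  intro k
  have hnp : (0 : ℝ) < n := by exact_mod_cast hn
  have hpos : 0 < (n : ℝ) * p := by positivity
  have h1 : (n : ℝ) * p ≤ (⌈(n : ℝ) * p⌉₊ : ℝ) := Nat.le_ceil _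
  have h2 : (⌈(n : ℝ) * p⌉₊ : ℝ) < n * p + 1 := Nat.ceil_lt_add_one hpos.le
  have hm : 1 ≤ ⌈(n : ℝ) * p⌉₊ := Nat.ceil_pos.2 hpos
  generalize ⌈(n : ℝ) * p⌉₊ = m at *
  have hle := ratioAux_le n m k p hp1 (by omega) h1 h2
  obtain ⟨N, rfl⟩ := Nat.exists_eq_add_of_le (show m ≤ n by omega)
  have hN : 1 ≤ N := by omega
  have hlt := ratioAux_exp_lt m N p hm hN hp1 h1
  have hNp : (0 : ℝ) < N := by exact_mod_cast hN
  have hc : (1 - (m : ℝ) / ((m + N : ℕ) : ℝ)) ^ (-(1 / 2) : ℝ) =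
      √((m + N : ℕ) : ℝ) / √(N : ℝ) := by
    have e : 1 - (m : ℝ) / ((m + N : ℕ) : ℝ) = N / ((m + N : ℕ) : ℝ) := by
      field_simp
      push_cast
      ring
    rw [e, Real.rpow_neg (by positivity), ← Real.sqrt_eq_rpow, Real.sqrt_div hNp.le, inv_div]
  rw [hc]
  have hb : binPMF (m + N) p k = ratioAux (m + N) p k * Real.exp (((m + N : ℕ) : ℝ) * p) *
      poissonPMF (((m + N : ℕ) : ℝ) * p) k := by
    unfold binPMF poissonPMF ratioAux
    rw [Nat.descFactorial_eq_factorial_mul_choose, Real.exp_neg, mul_pow]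
    push_cast
    have : ((m : ℝ) + N) ≠ 0 := by positivity
    field_simp
  rw [hb]
  have hP : 0 < poissonPMF (((m + N : ℕ) : ℝ) * p) k := by
    unfold poissonPMF
    positivity
  refine mul_lt_mul_of_pos_right (lt_of_le_of_lt ?_ hlt) hP
  gcongr
end

section
/- Let n ≥ 1 be an integer and p ∈ (0,1). Then the ratio Bin(n,p)({k})/Poiss(np)({k}) over k ∈ ℕ is maximized at k = ⌈np⌉; that is, for every k ∈ ℕ, Bin(n,p)({k}) · Poiss(np)({⌈np⌉}) ≤ Bin(n,p)({⌈np⌉}) · Poiss(np)({k}). -/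
theorem binPMF_step (n : ℕ) (p : ℝ) (k : ℕ) :
    binPMF n p (k+1) * ((k:ℝ)+1) * (1-p) = binPMF n p k * ((n:ℝ)-k) * p := by
  unfold binPMF
  rcases lt_trichotomy k n with h | h | h
  · obtain ⟨m, rfl⟩ := Nat.exists_eq_add_of_lt h
    have e := Nat.choose_succ_right_eq (k+m+1) k
    have e1 : k + m + 1 - k = m + 1 := by omega
    have e2 : k + m + 1 - (k+1) = m := by omega
    rw [e1] at e
    rw [e1, e2]
    have e' : (((k+m+1).choose (k+1) : ℕ) : ℝ) * ((k:ℝ)+1) = ((k+m+1).choose k : ℕ) * ((m:ℝ)+1) := by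
      exact_mod_cast e
    push_cast
    linear_combination (p^(k+1) * (1-p)^m * (1-p)) * e'
  · subst h
    simp
  · rw [Nat.choose_eq_zero_of_lt h, Nat.choose_eq_zero_of_lt (by omega : n < k+1)]
    simp

theorem poissonPMF_step (l : ℝ) (k : ℕ) :
    poissonPMF l (k+1) * ((k:ℝ)+1) = poissonPMF l k * l := by
  unfold poissonPMF
  rw [Nat.factorial_succ]
  have : (Nat.factorial k : ℝ) ≠ 0 := by positivity
  have h2 : (k:ℝ)+1 ≠ 0 := by positivity
  push_cast
  field_simp
  ring

theorem ratio_step (n : ℕ) (hn : 1 ≤ n) (p : ℝ) (hp0 : 0 < p) (hp1 : p < 1) (k : ℕ) :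
    binPMF n p (k+1) / poissonPMF (n*p) (k+1) * (n * (1-p)) =
      binPMF n p k / poissonPMF (n*p) k * ((n:ℝ)-k) := by
  have hn' : (0:ℝ) < n := by exact_mod_cast hn
  have hpos : ∀ j, 0 < poissonPMF (n*p) j := by
    intro j; unfold poissonPMF; positivity
  have a := hpos k
  have b := hpos (k+1)
  have h1 := binPMF_step n p k
  have h2 := poissonPMF_step (n*p) k
  have hk : (0:ℝ) < (k:ℝ)+1 := by positivity
  rw [div_mul_eq_mul_div, div_mul_eq_mul_div, div_eq_div_iff b.ne' a.ne']
  have : ((k:ℝ)+1) * p ≠ 0 := by positivity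
  apply mul_right_cancel₀ this
  linear_combination (n * poissonPMF (n*p) k * p) * h1 - (binPMF n p k * (n-k) * p) * h2

/-- For `n ≥ 1` and `p ∈ (0,1)`, the ratio `Bin(n,p)({k})/Poiss(np)({k})` is
maximized at `k = ⌈np⌉`. -/
theorem bin_poisson_ratio_max_at_ceil (n : ℕ) (hn : 1 ≤ n) (p : ℝ)
    (hp0 : 0 < p) (hp1 : p < 1) :
    ∀ k : ℕ, binPMF n p k * poissonPMF ((n : ℝ) * p) ⌈(n : ℝ) * p⌉₊ ≤
      binPMF n p ⌈(n : ℝ) * p⌉₊ * poissonPMF ((n : ℝ) * p) k := by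
  have hn' : (0:ℝ) < n := by exact_mod_cast hn
  have hpos : ∀ j, 0 < poissonPMF (n*p) j := by
    intro j; unfold poissonPMF; positivity
  have hq : 0 < 1 - p := by linarith
  have hD : 0 < (n:ℝ) * (1-p) := by positivity
  have hg : ∀ j, 0 ≤ binPMF n p j / poissonPMF (n*p) j := by
    intro j
    apply div_nonneg _ (hpos j).le
    unfold binPMF
    positivity
  intro k
  rw [← div_le_div_iff₀ (hpos _) (hpos _)]
  rcases le_total k ⌈(n : ℝ) * p⌉₊ with h | h
  · induction h using Nat.decreasingInduction with
    | self => exact le_rfl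
    | of_succ k hk ih =>
      refine le_trans ?_ ih
      have h1 := Nat.lt_ceil.mp hk
      have h2 := ratio_step n hn p hp0 hp1 k
      apply le_of_mul_le_mul_right _ hD
      rw [h2]
      exact mul_le_mul_of_nonneg_left (by linarith) (hg k)
  · induction k, h using Nat.le_induction with
    | base => exact le_rfl
    | succ k hk ih =>
      refine le_trans ?_ ih
      have h1 := Nat.ceil_le.mp hk
      have h2 := ratio_step n hn p hp0 hp1 k
      apply le_of_mul_le_mul_right _ hD
      rw [h2]
      exact mul_le_mul_of_nonneg_left (by linarith) (hg k)
end

section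
/- Let n ≥ 1 be an integer, let p ∈ (0,1), and set k := ⌈np⌉; assume k ≤ n − 1. Then the quantity D := log(Bin(n,p)({k})/Poiss(np)({k})) + log(1 − p)/2 satisfies −(k−1)/(12n(n−k+1)) − 1/(12(n−k)(n−k+1)) < D < −(k−1)/(12n(n−k+1)) + 1/(8(n−k)+6). -/
/-- Upper bound for `log (1+t)`. -/
lemma log_upper_aux {t : ℝ} (ht : 0 < t) :
    Real.log (1 + t) < 2 * t / (2 + t) + t ^ 3 / (6 * (1 + t) * (2 + t)) := by
  have key : StrictMonoOn (fun t : ℝ => 2 * t / (2 + t) + t ^ 3 / (6 * (1 + t) * (2 + t))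
      - Real.log (1 + t)) (Set.Ici 0) := by
    have hd : ∀ x : ℝ, 0 ≤ x → HasDerivAt (fun t : ℝ => 2 * t / (2 + t)
        + t ^ 3 / (6 * (1 + t) * (2 + t)) - Real.log (1 + t))
        ((2 * 1 * (2 + x) - 2 * x * 1) / (2 + x) ^ 2
        + ((3 * x ^ 2) * (6 * (1 + x) * (2 + x)) - x ^ 3 * (6 * 1 * (2 + x) + 6 * (1 + x) * 1))
          / (6 * (1 + x) * (2 + x)) ^ 2 - 1 / (1 + x)) x := by
      intro x hx
      have h2 : HasDerivAt (fun t : ℝ => 2 + t) 1 x := (hasDerivAt_id x).const_add 2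
      have h1 : HasDerivAt (fun t : ℝ => 1 + t) 1 x := (hasDerivAt_id x).const_add 1
      have h3 : HasDerivAt (fun t : ℝ => t ^ 3) (3 * x ^ 2) x := by
        simpa using hasDerivAt_pow 3 x
      have h4 : HasDerivAt (fun t : ℝ => 2 * t) (2 * 1) x := (hasDerivAt_id x).const_mul 2
      have hne : 6 * (1 + x) * (2 + x) ≠ 0 := by positivity
      exact ((h4.div h2 (by positivity)).add
        (h3.div ((h1.const_mul 6).mul h2) hne)).sub (h1.log (by positivity))
    refine strictMonoOn_of_deriv_pos (convex_Ici 0) ?_ ?_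
    · intro x hx
      exact (hd x hx).continuousAt.continuousWithinAt
    · intro x hx
      rw [interior_Ici] at hx
      have hx : 0 < x := hx
      rw [(hd x hx.le).deriv]
      have : ((2 * 1 * (2 + x) - 2 * x * 1) / (2 + x) ^ 2
        + ((3 * x ^ 2) * (6 * (1 + x) * (2 + x)) - x ^ 3 * (6 * 1 * (2 + x) + 6 * (1 + x) * 1))
          / (6 * (1 + x) * (2 + x)) ^ 2 - 1 / (1 + x))
          = x ^ 4 / (6 * (1 + x) ^ 2 * (2 + x) ^ 2) := by
        field_simp
        ring
      rw [this]
      positivity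
  have := key (Set.mem_Ici.2 le_rfl) (Set.mem_Ici.2 ht.le) ht
  simp at this
  linarith

/-- Lower bound for `log (1+y)`. -/
lemma log_lower_aux {y : ℝ} (hy : 0 ≤ y) :
    y - y ^ 2 / 2 + y ^ 3 / 3 - y ^ 4 / 4 ≤ Real.log (1 + y) := by
  have key : MonotoneOn (fun y : ℝ => Real.log (1 + y)
      - (y - y ^ 2 / 2 + y ^ 3 / 3 - y ^ 4 / 4)) (Set.Ici 0) := by
    have hd : ∀ x : ℝ, 0 ≤ x → HasDerivAt (fun y : ℝ => Real.log (1 + y)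
      - (y - y ^ 2 / 2 + y ^ 3 / 3 - y ^ 4 / 4)) (1 / (1 + x)
        - (1 - 2 * x / 2 + 3 * x ^ 2 / 3 - 4 * x ^ 3 / 4)) x := by
      intro x hx
      have h1 : HasDerivAt (fun t : ℝ => 1 + t) 1 x := (hasDerivAt_id x).const_add 1
      have h2 : HasDerivAt (fun t : ℝ => t ^ 2) (2 * x) x := by
        simpa using hasDerivAt_pow 2 x
      have h3 : HasDerivAt (fun t : ℝ => t ^ 3) (3 * x ^ 2) x := by
        simpa using hasDerivAt_pow 3 x
      have h4 : HasDerivAt (fun t : ℝ => t ^ 4) (4 * x ^ 3) x := by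
        simpa using hasDerivAt_pow 4 x
      exact (h1.log (by positivity)).sub
        ((((hasDerivAt_id x).sub (h2.div_const 2)).add (h3.div_const 3)).sub (h4.div_const 4))
    refine monotoneOn_of_deriv_nonneg (convex_Ici 0) ?_ ?_ ?_
    · intro x hx
      exact (hd x hx).continuousAt.continuousWithinAt
    · intro x hx
      rw [interior_Ici] at hx
      exact (hd x (le_of_lt hx)).differentiableAt.differentiableWithinAt
    · intro x hx
      rw [interior_Ici] at hx
      have hx : 0 < x := hx
      rw [(hd x hx.le).deriv]
      have : (1 / (1 + x) - (1 - 2 * x / 2 + 3 * x ^ 2 / 3 - 4 * x ^ 3 / 4))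
          = x ^ 4 / (1 + x) := by
        field_simp
        ring
      rw [this]
      positivity
  have := key (Set.mem_Ici.2 le_rfl) (Set.mem_Ici.2 hy) hy
  simp at this
  linarith

/-- Upper bound for `log (1-y)`. -/
lemma log_sub_aux {y : ℝ} (hy : 0 ≤ y) (hy1 : y < 1) :
    Real.log (1 - y) ≤ -(y + y ^ 2 / 2 + y ^ 3 / 3 + y ^ 4 / 4) := by
  have h := Real.hasSum_pow_div_log_of_abs_lt_one (x := y) (by rw [abs_of_nonneg hy]; exact hy1)
  have := sum_le_hasSum (Finset.range 4) (fun i _ => by positivity) h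
  simp [Finset.sum_range_succ] at this
  norm_num at this
  linarith

/-- Stirling-type difference. -/
noncomputable def sg (n : ℕ) : ℝ :=
  Real.log (n.factorial : ℝ) - ((n : ℝ) + 1 / 2) * Real.log n + n

/-- Shifted Stirling-type difference. -/
noncomputable def sh (m : ℕ) : ℝ :=
  Real.log (m.factorial : ℝ) - ((m : ℝ) + 1 / 2) * Real.log ((m : ℝ) + 1 / 2) + ((m : ℝ) + 1 / 2)

lemma log_fact_succ (j : ℕ) : Real.log ((j + 1).factorial : ℝ)
    = Real.log ((j : ℝ) + 1) + Real.log (j.factorial : ℝ) := by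
  rw [Nat.factorial_succ]
  push_cast
  rw [Real.log_mul (by positivity) (by positivity)]

lemma sg_step (j : ℕ) (hj : 1 ≤ j) :
    sg j - 1 / (12 * (j : ℝ)) < sg (j + 1) - 1 / (12 * ((j : ℝ) + 1)) := by
  have hx : (0 : ℝ) < j := by exact_mod_cast hj
  unfold sg
  rw [log_fact_succ]
  push_cast
  set x : ℝ := (j : ℝ)
  have h := log_upper_aux (t := 1 / x) (by positivity)
  have e : Real.log (1 + 1 / x) = Real.log (x + 1) - Real.log x := by
    rw [← Real.log_div (by positivity) (by positivity)]
    congr 1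
    field_simp
  rw [e] at h
  have h2 := mul_lt_mul_of_pos_left h (show 0 < x + 1 / 2 by positivity)
  have e2 : (x + 1 / 2) * (2 * (1 / x) / (2 + 1 / x)
      + (1 / x) ^ 3 / (6 * (1 + 1 / x) * (2 + 1 / x)))
      = 1 + 1 / (12 * x) - 1 / (12 * (x + 1)) := by
    field_simp
    ring
  rw [e2] at h2
  linarith

lemma sg_mono (a d : ℕ) (ha : 1 ≤ a) :
    sg a - 1 / (12 * (a : ℝ)) ≤ sg (a + d) - 1 / (12 * ((a + d : ℕ) : ℝ)) := by
  induction d with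
  | zero => simp
  | succ d ih =>
    have := sg_step (a + d) (by omega)
    push_cast at *
    rw [← add_assoc, ← add_assoc]
    linarith

lemma sh_step (m : ℕ) (hm : 1 ≤ m) :
    sh (m + 1) - 1 / (12 * ((m : ℝ) + 2)) + 1 / (8 * (m : ℝ) + 14)
      ≤ sh m - 1 / (12 * ((m : ℝ) + 1)) + 1 / (8 * (m : ℝ) + 6) := by
  have hm' : (1 : ℝ) ≤ m := by exact_mod_cast hm
  unfold sh
  rw [log_fact_succ]
  push_cast
  obtain ⟨z, hz⟩ : ∃ z : ℝ, (m : ℝ) = z + 1 := ⟨m - 1, by ring⟩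
  rw [hz] at hm' ⊢
  have hz0 : 0 ≤ z := by linarith
  have h1 := log_lower_aux (y := 1 / (2 * (z + 2))) (by positivity)
  have h2 := log_sub_aux (y := 1 / (2 * (z + 2))) (by positivity)
    (by rw [div_lt_one (by positivity)]; linarith)
  have e1 : Real.log (1 + 1 / (2 * (z + 2))) = Real.log (z + 1 + 1 + 1 / 2)
      - Real.log (z + 1 + 1) := by
    rw [← Real.log_div (by positivity) (by positivity)]
    congr 1
    field_simp
    ring
  have e2 : Real.log (1 - 1 / (2 * (z + 2))) = Real.log (z + 1 + 1 / 2)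
      - Real.log (z + 1 + 1) := by
    rw [← Real.log_div (by positivity) (by positivity)]
    congr 1
    field_simp
    ring
  rw [e1] at h1
  rw [e2] at h2
  have h1' := mul_le_mul_of_nonneg_left h1 (show 0 ≤ z + 1 + 1 + 1 / 2 by positivity)
  have h2' := mul_le_mul_of_nonneg_left h2 (show 0 ≤ z + 1 + 1 / 2 by positivity)
  have hr : 0 ≤ (z + 1 + 1 + 1 / 2) * (1 / (2 * (z + 2)) - (1 / (2 * (z + 2))) ^ 2 / 2
      + (1 / (2 * (z + 2))) ^ 3 / 3 - (1 / (2 * (z + 2))) ^ 4 / 4)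
      - (z + 1 + 1 / 2) * (-(1 / (2 * (z + 2)) + (1 / (2 * (z + 2))) ^ 2 / 2
      + (1 / (2 * (z + 2))) ^ 3 / 3 + (1 / (2 * (z + 2))) ^ 4 / 4))
      - 1 + 1 / (12 * (z + 1 + 2)) - 1 / (8 * (z + 1) + 14)
      - 1 / (12 * (z + 1 + 1)) + 1 / (8 * (z + 1) + 6) := by
    have hh : ∀ A : ℝ, A = (491 + 1361 * z + 1248 * z ^ 2 + 472 * z ^ 3 + 64 * z ^ 4)
        / (192 * ((z + 2) ^ 4 * (z + 3) * (4 * z + 11) * (4 * z + 7))) → 0 ≤ A := by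
      intro A hA
      rw [hA]
      positivity
    apply hh
    rw [show z + 1 + 2 = z + 3 by ring, show 8 * (z + 1) + 14 = 2 * (4 * z + 11) by ring,
      show 8 * (z + 1) + 6 = 2 * (4 * z + 7) by ring, show z + 1 + 1 = z + 2 by ring]
    field_simp
    ring
  linarith

lemma sh_mono (m d : ℕ) (hm : 1 ≤ m) :
    sh (m + d) - 1 / (12 * (((m + d : ℕ) : ℝ) + 1)) + 1 / (8 * ((m + d : ℕ) : ℝ) + 6)
      ≤ sh m - 1 / (12 * ((m : ℝ) + 1)) + 1 / (8 * (m : ℝ) + 6) := by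
  induction d with
  | zero => simp
  | succ d ih =>
    have := sh_step (m + d) (by omega)
    push_cast at *
    rw [← add_assoc, ← add_assoc]
    have e1 : (m : ℝ) + d + 1 + 1 = m + d + 2 := by ring
    have e2 : 8 * ((m : ℝ) + d + 1) + 6 = 8 * (m + d) + 14 := by ring
    rw [e1, e2]
    linarith

lemma sg_lt_sh (n : ℕ) (hn : 2 ≤ n) :
    sg n - 1 / (12 * (n : ℝ)) < sh n - 1 / (12 * ((n : ℝ) + 1)) + 1 / (8 * (n : ℝ) + 6) := by
  have hm' : (2 : ℝ) ≤ n := by exact_mod_cast hn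
  unfold sg sh
  obtain ⟨z, hz⟩ : ∃ z : ℝ, (n : ℝ) = z + 2 := ⟨n - 2, by ring⟩
  rw [hz] at hm' ⊢
  have hz0 : 0 ≤ z := by linarith
  have h1 := log_upper_aux (t := 1 / (2 * (z + 2))) (by positivity)
  have e1 : Real.log (1 + 1 / (2 * (z + 2))) = Real.log (z + 2 + 1 / 2)
      - Real.log (z + 2) := by
    rw [← Real.log_div (by positivity) (by positivity)]
    congr 1
    field_simp
  rw [e1] at h1
  have h1' := mul_lt_mul_of_pos_left h1 (show 0 < z + 2 + 1 / 2 by positivity)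
  have hr : 0 ≤ 1 / 2 + 1 / (12 * (z + 2)) - 1 / (12 * (z + 2 + 1)) + 1 / (8 * (z + 2) + 6)
      - (z + 2 + 1 / 2) * (2 * (1 / (2 * (z + 2))) / (2 + 1 / (2 * (z + 2)))
      + (1 / (2 * (z + 2))) ^ 3 / (6 * (1 + 1 / (2 * (z + 2))) * (2 + 1 / (2 * (z + 2))))) := by
    have hh : ∀ A : ℝ, A = (42 + 55 * z + 25 * z ^ 2 + 4 * z ^ 3)
        / (24 * ((z + 2) ^ 2 * (z + 3) * (4 * z + 11) * (4 * z + 9))) → 0 ≤ A := by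
      intro A hA
      rw [hA]
      positivity
    apply hh
    rw [show z + 2 + 1 = z + 3 by ring, show 8 * (z + 2) + 6 = 2 * (4 * z + 11) by ring,
      show 1 + 1 / (2 * (z + 2)) = (2 * z + 5) / (2 * (z + 2)) by field_simp; ring,
      show 2 + 1 / (2 * (z + 2)) = (4 * z + 9) / (2 * (z + 2)) by field_simp; ring,
      show z + 2 + 1 / 2 = (2 * z + 5) / 2 by ring]
    field_simp
    ring
  linarith

theorem bin_poisson_refined_bounds (n : ℕ) (hn : 1 ≤ n) (p : ℝ)
    (hp0 : 0 < p) (hp1 : p < 1) (k : ℕ) (hk : k = ⌈(n : ℝ) * p⌉₊) (hkn : k ≤ n - 1) :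
    -(((k : ℝ) - 1) / (12 * n * ((n : ℝ) - k + 1)))
        - 1 / (12 * ((n : ℝ) - k) * ((n : ℝ) - k + 1)) <
      Real.log (binPMF n p k / poissonPMF ((n : ℝ) * p) k) + Real.log (1 - p) / 2 ∧
    Real.log (binPMF n p k / poissonPMF ((n : ℝ) * p) k) + Real.log (1 - p) / 2 <
      -(((k : ℝ) - 1) / (12 * n * ((n : ℝ) - k + 1))) + 1 / (8 * ((n : ℝ) - k) + 6) := by
  have hn0 : (0 : ℝ) < n := by exact_mod_cast hn
  have hnp : 0 < (n : ℝ) * p := by positivity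
  have hk1 : 1 ≤ k := by rw [hk]; exact Nat.one_le_iff_ne_zero.2 (Nat.ceil_pos.2 hnp).ne'
  have hle : (n : ℝ) * p ≤ k := by rw [hk]; exact Nat.le_ceil _
  have hlt : (k : ℝ) < n * p + 1 := by rw [hk]; exact Nat.ceil_lt_add_one hnp.le
  clear hk
  obtain ⟨m, rfl⟩ : ∃ m, n = m + k := ⟨n - k, by omega⟩
  have hm : 1 ≤ m := by omega
  have hm0 : (1 : ℝ) ≤ m := by exact_mod_cast hm
  have hkr : (1 : ℝ) ≤ k := by exact_mod_cast hk1
  have hq : 0 < 1 - p := by linarith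
  set u : ℝ := ((m + k : ℕ) : ℝ) * (1 - p) with hu
  have hu' : u = ((m + k : ℕ) : ℝ) - ((m + k : ℕ) : ℝ) * p := by rw [hu]; ring
  have hum : (m : ℝ) ≤ u := by rw [hu']; push_cast at *; linarith
  have hum1 : u < m + 1 := by rw [hu']; push_cast at *; linarith
  have hu0 : 0 < u := by linarith
  have hlogu : Real.log (1 - p) = Real.log u - Real.log ((m + k : ℕ) : ℝ) := by
    rw [hu, Real.log_mul hn0.ne' hq.ne']; ring
  have hratio : binPMF (m + k) p k / poissonPMF (((m + k : ℕ) : ℝ) * p) k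
      = ((m + k).factorial : ℝ) / (m.factorial : ℝ) / ((m + k : ℕ) : ℝ) ^ k
        * (1 - p) ^ m * Real.exp (((m + k : ℕ) : ℝ) * p) := by
    unfold binPMF poissonPMF
    have hc : ((m + k).choose k : ℝ) * (m.factorial : ℝ) * (k.factorial : ℝ)
        = ((m + k).factorial : ℝ) := by
      have := Nat.add_choose_mul_factorial_mul_factorial m k
      exact_mod_cast this
    rw [← hc, Nat.add_sub_cancel, Real.exp_neg, mul_pow]
    field_simp
  have hD : Real.log (binPMF (m + k) p k / poissonPMF (((m + k : ℕ) : ℝ) * p) k)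
      + Real.log (1 - p) / 2
      = sg (m + k) - (Real.log (m.factorial : ℝ) - ((m : ℝ) + 1 / 2) * Real.log u + u) := by
    rw [hratio, Real.log_mul (by positivity) (by positivity),
      Real.log_mul (by positivity) (by positivity), Real.log_div (by positivity) (by positivity),
      Real.log_div (by positivity) (by positivity), Real.log_pow, Real.log_pow, Real.log_exp,
      hlogu, hu']
    unfold sg
    push_cast
    ring
  rw [hD]
  have ebase : -(((k : ℝ) - 1) / (12 * ((m + k : ℕ) : ℝ) * (((m + k : ℕ) : ℝ) - k + 1)))
      = 1 / (12 * ((m + k : ℕ) : ℝ)) - 1 / (12 * ((m : ℝ) + 1)) := by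
    push_cast
    rw [show (m : ℝ) + k - k + 1 = m + 1 by ring]
    field_simp
    ring
  rw [ebase]
  have em : ((m + k : ℕ) : ℝ) - k = m := by push_cast; ring
  rw [em]
  clear hD hratio ebase em
  constructor
  · have eb : 1 / (12 * (m : ℝ) * (m + 1)) = 1 / (12 * (m : ℝ)) - 1 / (12 * ((m : ℝ) + 1)) := by
      field_simp
      ring
    rw [eb]
    have hgap : 0 < 1 / (12 * (m : ℝ) * (m + 1)) := by positivity
    rw [eb] at hgap
    obtain ⟨d, rfl⟩ : ∃ d, k = 1 + d := ⟨k - 1, by omega⟩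
    have h1 := sg_mono (m + 1) d (by omega)
    have h0 := sg_step m hm
    rw [add_assoc] at h1
    have hconc := strictConcaveOn_log_Ioi.concaveOn.2
      (Set.mem_Ioi.2 (show (0 : ℝ) < (m : ℝ) by linarith))
      (Set.mem_Ioi.2 (show (0 : ℝ) < (m : ℝ) + 1 by linarith))
      (show (0 : ℝ) ≤ 1 - (u - m) by linarith) (show (0 : ℝ) ≤ u - m by linarith) (by ring)
    simp only [smul_eq_mul] at hconc
    rw [show (1 - (u - (m : ℝ))) * m + (u - m) * (m + 1) = u by ring] at hconc
    have hc2 := mul_le_mul_of_nonneg_left hconc (show 0 ≤ (m : ℝ) + 1 / 2 by positivity)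
    generalize hS : sg (m + (1 + d)) = S at *
    unfold sg at h0 h1
    rw [log_fact_succ] at h0 h1
    push_cast at *
    set l0 := Real.log (m : ℝ)
    set l1 := Real.log ((m : ℝ) + 1)
    set B := 1 / (12 * ((m : ℝ) + (1 + d)))
    set B0 := 1 / (12 * (m : ℝ))
    set B1 := 1 / (12 * ((m : ℝ) + 1))
    set F := Real.log (m.factorial : ℝ)
    have hA : 0 < S - (F - ((m : ℝ) + 1 / 2) * l0 + m) - (B - B0) := by linarith
    have hB : 0 < S - (F - ((m : ℝ) + 1 / 2) * l1 + (m + 1)) - (B - B0) := by linarith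
    have hcomb : 0 < (1 - (u - m)) * (S - (F - ((m : ℝ) + 1 / 2) * l0 + m) - (B - B0))
        + (u - m) * (S - (F - ((m : ℝ) + 1 / 2) * l1 + (m + 1)) - (B - B0)) :=
      add_pos_of_pos_of_nonneg (mul_pos (by linarith) hA) (mul_nonneg (by linarith) hB.le)
    linarith
  · have h1 := sh_mono m k hm
    have h2 := sg_lt_sh (m + k) (by omega)
    have ha : 0 < (m : ℝ) + 1 / 2 := by positivity
    have hl := Real.log_le_sub_one_of_pos (show 0 < u / ((m : ℝ) + 1 / 2) by positivity)
    rw [Real.log_div hu0.ne' ha.ne'] at hl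
    have hl2 := mul_le_mul_of_nonneg_left hl ha.le
    have e3 : ((m : ℝ) + 1 / 2) * (u / ((m : ℝ) + 1 / 2) - 1) = u - (m + 1 / 2) := by
      field_simp
    rw [e3] at hl2
    have h3 : sh m ≤ Real.log (m.factorial : ℝ) - ((m : ℝ) + 1 / 2) * Real.log u + u := by
      unfold sh
      linarith
    linarith
end

section
/- Let n > k + 2 be positive integers. Let γ_n be the n-fold product of the standard Gaussian measure N(0,1) on ℝ^n, let r_n > 0, and let Q_{n,k} be the pushforward of γ_n under the map z ↦ (r_n/‖z‖)·(z_1,…,z_k) (where ‖·‖ is the Euclidean norm; the map is defined γ_n-a.e.), and let P_k be the k-fold product of N(0,1) on ℝ^k. If either r_n = √n and δ := (k+2)/n, or r_n = √(n−2) and δ := k/(n−2), then for every Borel set A ⊆ ℝ^k, Q_{n,k}(A) ≤ (1 − δ)^{−1/2} · P_k(A), and d_TV(Q_{n,k}, P_k) < 1 − √(1 − δ) < δ/(2 − δ). -/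
open MeasureTheory ProbabilityTheory

/-- Logarithm of the Stirling ratio. -/
noncomputable def stirL (x : ℝ) : ℝ := Real.log (Real.Gamma x) + x - (x - 1/2) * Real.log x

lemma stirL_sub_hasSum {x : ℝ} (hx : 0 < x) :
    HasSum (fun j : ℕ => (1 / (2 * (j:ℝ) + 3)) * ((1 / (2 * x + 1)) ^ 2) ^ (j + 1))
      (stirL x - stirL (x + 1)) := by
  have h := (Real.hasSum_log_one_add_inv hx).mul_left (x + 1/2)
  have h2 := (hasSum_nat_add_iff' 1).mpr h
  convert! h2 using 1
  · funext j
    have hq : (x + 1/2) * 2 * (1 / (2 * x + 1)) = 1 := by field_simp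
    generalize 1 / (2 * x + 1) = q at hq ⊢
    have e3 : (2 * ((j + 1 : ℕ) : ℝ) + 1) = 2 * (j:ℝ) + 3 := by push_cast; ring
    rw [e3, ← pow_mul]
    linear_combination (-(1 / (2 * (j:ℝ) + 3)) * q ^ (2 * (j + 1))) * hq
  · have e1 : (1 + x⁻¹) = (x + 1) / x := by field_simp
    rw [e1, Real.log_div (by positivity) (by positivity)]
    unfold stirL
    rw [Real.Gamma_add_one hx.ne', Real.log_mul hx.ne' (Real.Gamma_pos_of_pos hx).ne']
    simp
    field_simp
    ring

lemma stirL_diff_lt {x y : ℝ} (hx : 0 < x) (hxy : x < y) :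
    stirL y - stirL (y + 1) < stirL x - stirL (x + 1) := by
  have hy : 0 < y := hx.trans hxy
  have hb : (1 / (2 * y + 1)) < (1 / (2 * x + 1)) := by
    apply one_div_lt_one_div_of_lt <;> linarith
  have hb0 : 0 < (1 / (2 * y + 1)) := by positivity
  refine hasSum_lt (i := 0) (fun j => ?_) ?_ (stirL_sub_hasSum hy) (stirL_sub_hasSum hx)
  · dsimp only
    gcongr
  · gcongr

lemma stirL_diff_le (x t : ℝ) (hx : 1 / 2 < x) (ht : 0 < t) :
    stirL (x + t) - stirL x ≤ t * (t + 1/2) / (x + t) := by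
  have hx0 : 0 < x := by linarith
  have hc := Real.convexOn_log_Gamma.slope_mono_adjacent (x := x) (y := x + t) (z := x + t + 1)
    (by simpa using hx0) (by simp; linarith) (by linarith) (by linarith)
  simp only [Function.comp] at hc
  have hxt : 0 < x + t := by linarith
  rw [Real.Gamma_add_one hxt.ne', Real.log_mul hxt.ne' (Real.Gamma_pos_of_pos hxt).ne'] at hc
  have e1 : x + t - x = t := by ring
  have e2 : x + t + 1 - (x + t) = 1 := by ring
  rw [e1, e2, div_le_iff₀ ht] at hc
  have hl : t / (x + t) ≤ Real.log (x + t) - Real.log x := by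
    rw [← Real.log_div hxt.ne' hx0.ne']
    have := Real.one_sub_inv_le_log_of_pos (x := (x + t) / x) (by positivity)
    refine le_trans (le_of_eq ?_) this
    field_simp
    ring
  have h3 : (x - 1/2) * (t / (x + t)) ≤ (x - 1/2) * (Real.log (x + t) - Real.log x) :=
    mul_le_mul_of_nonneg_left hl (by linarith)
  have h4 : t * (t + 1/2) / (x + t) = t - (x - 1/2) * (t / (x + t)) := by
    field_simp
    ring
  rw [h4]
  unfold stirL
  nlinarith

lemma stirL_anti_iter {x y : ℝ} (hx : 0 < x) (hxy : x < y) (N : ℕ) :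
    stirL y - stirL x ≤ stirL (y + N) - stirL (x + N) := by
  induction N with
  | zero => simp
  | succ N ih =>
    have := stirL_diff_lt (x := x + N) (y := y + N) (by positivity) (by linarith)
    push_cast
    rw [← add_assoc, ← add_assoc]
    linarith

lemma stirL_le {x y : ℝ} (hx : 0 < x) (hxy : x < y) : stirL y ≤ stirL x := by
  have ht : 0 < y - x := by linarith
  have hlim : Filter.Tendsto (fun N : ℕ => (y - x) * ((y - x) + 1/2) / ((N : ℝ) + y))
      Filter.atTop (nhds 0) :=
    tendsto_const_nhds.div_atTop
      (Filter.tendsto_atTop_add_const_right _ _ tendsto_natCast_atTop_atTop)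
  have := ge_of_tendsto hlim (b := stirL y - stirL x) ?_
  · linarith
  · filter_upwards [Filter.eventually_ge_atTop 1] with N hN
    have hN' : (1:ℝ) ≤ N := by exact_mod_cast hN
    have h1 := stirL_anti_iter hx hxy N
    have h2 := stirL_diff_le (x + N) (y - x) (by linarith) ht
    have e : x + N + (y - x) = N + y := by ring
    rw [e] at h2
    rw [add_comm y] at h1
    linarith

lemma stirL_lt {x y : ℝ} (hx : 0 < x) (hxy : x < y) : stirL y < stirL x := by
  have := stirL_diff_lt hx hxy
  have := stirL_le (x := x + 1) (y := y + 1) (by linarith) (by linarith)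
  linarith

/-- The improved constant. -/
noncomputable def lpK (a b ρ : ℝ) : ℝ :=
  Real.Gamma a / Real.Gamma b * ρ ^ (-(a - b)) * (((b - 1) / ρ) ^ (b - 1) * Real.exp (ρ - (b - 1)))

lemma lpK_pos {a b ρ : ℝ} (ha : 0 < a) (hb : 1 < b) (hρ : 0 < ρ) : 0 < lpK a b ρ := by
  have : 0 < b - 1 := by linarith
  have := Real.Gamma_pos_of_pos ha
  have := Real.Gamma_pos_of_pos (show 0 < b by linarith)
  unfold lpK
  positivity

lemma lpK_lt {a b ρ : ℝ} (ha : 0 < a) (hb : 1 < b) (hρ : b - 1 < ρ)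
    (hG : Real.Gamma a = Real.Gamma ρ * ρ ^ (a - ρ)) :
    lpK a b ρ < ((b - 1) / ρ) ^ (-(1 / 2) : ℝ) := by
  have hβ : 0 < b - 1 := by linarith
  have hρ0 : 0 < ρ := by linarith
  have hG1 := Real.Gamma_pos_of_pos ha
  have hG2 := Real.Gamma_pos_of_pos (show 0 < b by linarith)
  have hG3 := Real.Gamma_pos_of_pos hρ0
  have hG4 := Real.Gamma_pos_of_pos hβ
  have key := stirL_lt hβ hρ
  have hGb : Real.Gamma b = (b - 1) * Real.Gamma (b - 1) := by
    rw [← Real.Gamma_add_one hβ.ne']; congr 1; ring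
  rw [← Real.log_lt_log_iff (lpK_pos ha hb hρ0) (by positivity)]
  unfold lpK
  rw [Real.log_mul (by positivity) (by positivity), Real.log_mul (by positivity) (by positivity),
    Real.log_mul (by positivity) (by positivity), Real.log_exp, Real.log_rpow (by positivity),
    Real.log_rpow (by positivity), Real.log_rpow (by positivity), Real.log_div hβ.ne' hρ0.ne',
    Real.log_div hG1.ne' hG2.ne', hG, hGb, Real.log_mul (by positivity) (by positivity),
    Real.log_mul (by positivity) (by positivity), Real.log_rpow (by positivity)]
  unfold stirL at key
  nlinarith

lemma lp_max {β ρ v : ℝ} (hβ : 0 < β) (hρ : 0 < ρ) (hv : v ≤ ρ) :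
    (1 - v / ρ) ^ β ≤ (β / ρ) ^ β * Real.exp (ρ - β) * Real.exp (-v) := by
  have h0 : 0 ≤ 1 - v / ρ := by
    rw [sub_nonneg, div_le_one hρ]; exact hv
  have h1 : 1 - v / ρ ≤ (β / ρ) * Real.exp ((ρ - β - v) / β) := by
    have := Real.add_one_le_exp ((ρ - β - v) / β)
    calc 1 - v / ρ = (β / ρ) * ((ρ - β - v) / β + 1) := by field_simp; ring
      _ ≤ _ := by gcongr
  calc (1 - v / ρ) ^ β ≤ ((β / ρ) * Real.exp ((ρ - β - v) / β)) ^ β :=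
        Real.rpow_le_rpow h0 h1 hβ.le
    _ = _ := by
        rw [Real.mul_rpow (by positivity) (by positivity), ← Real.exp_mul, mul_assoc,
          ← Real.exp_add]
        congr 2
        field_simp
        ring

noncomputable def gD (k : ℕ) (s : ℝ) : ℝ := ((Real.sqrt (2 * Real.pi))⁻¹) ^ k * Real.exp (-s / 2)

lemma gD_nonneg (k : ℕ) (s : ℝ) : 0 ≤ gD k s := by unfold gD; positivity

lemma gD_eq_prod (k : ℕ) (x : Fin k → ℝ) :
    gD k (∑ i, x i ^ 2) = ∏ i, gaussianPDFReal 0 1 (x i) := by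
  simp only [gaussianPDFReal, Finset.prod_mul_distrib, ← Real.exp_sum, gD]
  simp [Finset.sum_div, neg_div]

lemma pi_gaussian_eq (k : ℕ) :
    (Measure.pi fun _ : Fin k => gaussianReal 0 1) =
      (volume : Measure (Fin k → ℝ)).withDensity
        (fun x => ENNReal.ofReal (gD k (∑ i, x i ^ 2))) := by
  refine Measure.pi_eq fun s hs => ?_
  rw [withDensity_apply _ (MeasurableSet.univ_pi hs), volume_pi, Measure.restrict_pi_pi]
  simp_rw [gD_eq_prod]
  have hint : Integrable (fun x : Fin k → ℝ => ∏ i, gaussianPDFReal 0 1 (x i))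
      (Measure.pi fun i => (volume : Measure ℝ).restrict (s i)) :=
    Integrable.fintype_prod (f := fun _ => gaussianPDFReal 0 1)
      fun i => (integrable_gaussianPDFReal 0 1).restrict
  rw [← ofReal_integral_eq_lintegral_ofReal hint
    (Filter.Eventually.of_forall fun x => Finset.prod_nonneg fun i _ => gaussianPDFReal_nonneg _ _ _)]
  rw [integral_fintype_prod_eq_prod (f := fun _ => gaussianPDFReal 0 1),
    ENNReal.ofReal_prod_of_nonneg]
  · refine Finset.prod_congr rfl fun i _ => ?_
    rw [gaussianReal_apply_eq_integral _ one_ne_zero]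
  · exact fun i _ => integral_nonneg fun x => gaussianPDFReal_nonneg _ _ _

lemma chi_sq (m : ℕ) (hm : 1 ≤ m) :
    (Measure.pi fun _ : Fin m => gaussianReal 0 1).map (fun y => ∑ i, y i ^ 2) =
      gammaMeasure (m / 2) (1 / 2) := by
  have hm0 : (0:ℝ) < m / 2 := by positivity
  have hmeas : Measurable (fun y : Fin m → ℝ => ∑ i, y i ^ 2) := by fun_prop
  have := isProbabilityMeasure_gammaMeasure hm0 (show (0:ℝ) < 1/2 by norm_num)
  have : IsProbabilityMeasure
    ((Measure.pi fun _ : Fin m => gaussianReal 0 1).map (fun y => ∑ i, y i ^ 2)) :=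
    Measure.isProbabilityMeasure_map hmeas.aemeasurable
  -- both measures are proportional
  obtain ⟨c, hc⟩ : ∃ c : ℝ, ∀ S : Set ℝ, MeasurableSet S →
      ((Measure.pi fun _ : Fin m => gaussianReal 0 1).map (fun y => ∑ i, y i ^ 2)).real S =
        c * (gammaMeasure (m / 2) (1 / 2)).real S := by
    refine ⟨m * (volume : Measure (EuclideanSpace ℝ (Fin m))).real (Metric.ball 0 1) *
      (((Real.sqrt (2 * Real.pi))⁻¹) ^ m * (1 / 2) / ((1/2) ^ ((m:ℝ)/2) / Real.Gamma (m/2))), fun S hS => ?_⟩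
    have h1 : ((Measure.pi fun _ : Fin m => gaussianReal 0 1).map (fun y => ∑ i, y i ^ 2)).real S
        = ∫ y : EuclideanSpace ℝ (Fin m), S.indicator (fun s => gD m s) (‖y‖ ^ 2) := by
      rw [measureReal_def, Measure.map_apply hmeas hS, pi_gaussian_eq,
        withDensity_apply _ (hmeas hS), ← lintegral_indicator (hmeas hS),
        ← (PiLp.volume_preserving_ofLp (Fin m)).lintegral_comp_emb
          (MeasurableEquiv.toLp 2 (Fin m → ℝ)).symm.measurableEmbedding,
        integral_eq_lintegral_of_nonneg_ae]
      · congr 2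
        funext y
        rw [EuclideanSpace.real_norm_sq_eq]
        by_cases h : (∑ i, y.ofLp i ^ 2) ∈ S
        · simp [Set.indicator, h]
        · simp [Set.indicator, h]
      · exact Filter.Eventually.of_forall fun y => Set.indicator_nonneg (fun _ _ => gD_nonneg _ _) _
      · apply Measurable.aestronglyMeasurable
        have : Measurable (S.indicator (fun s => gD m s)) :=
          Measurable.indicator (by unfold gD; fun_prop) hS
        exact this.comp (by fun_prop)
    have h2 : (gammaMeasure (m / 2) (1 / 2)).real S =
        ∫ t in Set.Ioi (0:ℝ), S.indicator (fun t => gammaPDFReal (m/2) (1/2) t) t := by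
      rw [measureReal_def, gammaMeasure, withDensity_apply _ hS, ← lintegral_indicator hS,
        ← integral_Ici_eq_integral_Ioi, setIntegral_eq_integral_of_forall_compl_eq_zero,
        integral_eq_lintegral_of_nonneg_ae]
      · congr 2
        funext y
        by_cases h : y ∈ S
        · simp [Set.indicator, h, gammaPDF]
        · simp [Set.indicator, h]
      · exact Filter.Eventually.of_forall fun y => Set.indicator_nonneg
          (fun _ _ => gammaPDFReal_nonneg hm0 (by norm_num) _) _
      · exact ((measurable_gammaPDFReal _ _).indicator hS).aestronglyMeasurable
      · intro x hx
        simp only [Set.mem_Ici, not_le] at hx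
        simp [Set.indicator, gammaPDFReal, hx.not_ge]
    have : Nonempty (Fin m) := ⟨⟨0, hm⟩⟩
    rw [h1, h2, integral_fun_norm_addHaar volume
      (fun ρ => S.indicator (fun s => gD m s) (ρ ^ 2)),
      ← integral_comp_rpow_Ioi_of_pos (p := 2)
        (g := fun t => S.indicator (fun t => gammaPDFReal (m/2) (1/2) t) t) (by norm_num), finrank_euclideanSpace,
      Fintype.card_fin, nsmul_eq_mul, smul_eq_mul,
      mul_assoc ((m:ℝ) * _) _ _, mul_assoc (m:ℝ) _ _]
    congr 2
    rw [← integral_const_mul]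
    refine setIntegral_congr_fun measurableSet_Ioi fun y hy => ?_
    have hy : 0 < y := hy
    have hG := Real.Gamma_pos_of_pos hm0
    simp only [Real.rpow_two, smul_eq_mul]
    by_cases h : y ^ 2 ∈ S
    · simp only [Set.indicator, h, if_true, gammaPDFReal, sq_nonneg, gD]
      have e : (y ^ 2) ^ ((m:ℝ) / 2 - 1) * y = y ^ (m - 1) := by
        rw [← Real.rpow_natCast y 2, ← Real.rpow_mul hy.le]
        nth_rewrite 2 [← Real.rpow_one y]
        rw [← Real.rpow_add hy, ← Real.rpow_natCast]
        congr 1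
        push_cast [hm]
        ring
      rw [← e]
      have e2 : (2:ℝ) - 1 = 1 := by norm_num
      have e3 : -(y^2) / 2 = -(1/2 * y^2) := by ring
      rw [e2, Real.rpow_one, e3]
      have : (0:ℝ) < (1/2) ^ ((m:ℝ)/2) := by positivity
      field_simp
    · simp [Set.indicator, h]
  have h1 := hc Set.univ MeasurableSet.univ
  simp only [probReal_univ, mul_one] at h1
  ext S hS
  have := hc S hS
  rw [← h1, one_mul] at this
  exact (measureReal_eq_measureReal_iff).mp this

lemma lp_pointwise (k m : ℕ) (hm : 3 ≤ m) {r s t : ℝ} (hr : 0 < r) (ht : 0 < t) :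
    (Real.sqrt t / r) ^ k * (gD k (t / r ^ 2 * s) * gammaPDFReal (m / 2) (1 / 2) (t - t / r ^ 2 * s))
      ≤ lpK ((k + m) / 2) (m / 2) (r ^ 2 / 2) *
        (gD k s * gammaPDFReal ((k + m) / 2) (1 / 2) t) := by
  have hm' : (3:ℝ) ≤ m := by exact_mod_cast hm
  have ha : (0:ℝ) < (k + m) / 2 := by positivity
  have hb : (1:ℝ) < m / 2 := by linarith
  have hK := lpK_pos ha hb (show 0 < r ^ 2 / 2 by positivity)
  by_cases h : 0 ≤ t - t / r ^ 2 * s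
  swap
  · rw [gammaPDFReal, if_neg h, mul_zero, mul_zero]
    exact mul_nonneg hK.le (mul_nonneg (gD_nonneg _ _) (gammaPDFReal_nonneg ha (by norm_num) _))
  have he : t - t / r ^ 2 * s = t * (1 - (s / 2) / (r ^ 2 / 2)) := by field_simp
  have h0 : 0 ≤ 1 - (s / 2) / (r ^ 2 / 2) := by
    rw [he] at h
    exact nonneg_of_mul_nonneg_right h ht
  have hs : s / 2 ≤ r ^ 2 / 2 := by
    rwa [sub_nonneg, div_le_one (by positivity)] at h0
  have hmax := lp_max (β := (m:ℝ) / 2 - 1) (by linarith) (show 0 < r ^ 2 / 2 by positivity) hs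
  have hG1 := Real.Gamma_pos_of_pos ha
  have hG2 := Real.Gamma_pos_of_pos (show (0:ℝ) < m / 2 by linarith)
  rw [gammaPDFReal, if_pos h, gammaPDFReal, if_pos ht.le]
  have e1 : (Real.sqrt t / r) ^ k = t ^ ((k:ℝ) / 2) * (r ^ 2) ^ (-((k:ℝ) / 2)) := by
    rw [div_pow, Real.sqrt_eq_rpow, ← Real.rpow_natCast (t ^ (1/2 : ℝ)), ← Real.rpow_mul ht.le,
      Real.rpow_neg (by positivity), ← Real.rpow_natCast r 2, ← Real.rpow_mul hr.le,
      ← Real.rpow_natCast r k, div_eq_mul_inv]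
    congr 2
    · ring
    · congr 1; push_cast; ring
  have e2 : (t - t / r ^ 2 * s) ^ ((m:ℝ) / 2 - 1) =
      t ^ ((m:ℝ) / 2 - 1) * (1 - (s / 2) / (r ^ 2 / 2)) ^ ((m:ℝ) / 2 - 1) := by
    rw [he, Real.mul_rpow ht.le h0]
  have e3 : t ^ (((k:ℝ) + m) / 2 - 1) = t ^ ((k:ℝ) / 2) * t ^ ((m:ℝ) / 2 - 1) := by
    rw [← Real.rpow_add ht]; congr 1; ring
  have e4 : ((1:ℝ) / 2) ^ (((k:ℝ) + m) / 2) = (1 / 2) ^ ((k:ℝ) / 2) * (1 / 2) ^ ((m:ℝ) / 2) := by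
    rw [← Real.rpow_add (by norm_num)]; congr 1; ring
  have e5 : (r ^ 2 / 2) ^ (-(((k:ℝ) + m) / 2 - m / 2)) =
      (r ^ 2) ^ (-((k:ℝ) / 2)) * ((1 / 2) ^ ((k:ℝ) / 2))⁻¹ := by
    rw [div_eq_mul_one_div, Real.mul_rpow (by positivity) (by norm_num), ← Real.rpow_neg (by norm_num)]
    congr 2 <;> ring
  have e6 : Real.exp (-(t / r ^ 2 * s) / 2) * Real.exp (-(1 / 2 * (t - t / r ^ 2 * s))) =
      Real.exp (-(1 / 2 * t)) := by
    rw [← Real.exp_add]; congr 1; ring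
  have e7 : Real.exp (-s / 2) = Real.exp (-(s / 2)) := by congr 1; ring
  unfold lpK gD
  rw [e1, e2, e3, e4, e5, e7, ← e6]
  have hh : (0:ℝ) < (1 / 2) ^ ((k:ℝ) / 2) := by positivity
  have hM : 0 ≤ t ^ ((k:ℝ) / 2) * (r ^ 2) ^ (-((k:ℝ) / 2)) * ((Real.sqrt (2 * Real.pi))⁻¹) ^ k *
      Real.exp (-(t / r ^ 2 * s) / 2) * ((1 / 2) ^ ((m:ℝ) / 2) / Real.Gamma (m / 2)) *
      t ^ ((m:ℝ) / 2 - 1) * Real.exp (-(1 / 2 * (t - t / r ^ 2 * s))) := by positivity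
  have hfin := mul_le_mul_of_nonneg_left hmax hM
  refine (le_of_eq ?_).trans (hfin.trans (le_of_eq ?_))
  · ring
  · generalize (1 / 2 : ℝ) ^ ((k:ℝ) / 2) = h1 at hh ⊢
    generalize Real.Gamma ((k + m) / 2) = g1 at hG1 ⊢
    generalize (((m:ℝ) / 2 - 1) / (r ^ 2 / 2)) ^ ((m:ℝ) / 2 - 1) = g2
    generalize Real.exp (r ^ 2 / 2 - (m / 2 - 1)) = g3
    have i1 : h1⁻¹ * h1 = 1 := inv_mul_cancel₀ hh.ne'
    have i2 : g1 * g1⁻¹ = 1 := mul_inv_cancel₀ hG1.ne'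
    simp only [div_eq_mul_inv g1, div_eq_mul_inv _ g1]
    generalize h1⁻¹ = h2 at *
    generalize g1⁻¹ = g4 at *
    generalize t ^ ((k:ℝ) / 2) = T1
    generalize t ^ ((m:ℝ) / 2 - 1) = T2
    generalize (r ^ 2) ^ (-((k:ℝ) / 2)) = R
    generalize Real.exp (-(t / r ^ 2 * s) / 2) = E1
    generalize Real.exp (-(1 / 2 * (t - t / r ^ 2 * s))) = E2
    generalize Real.exp (-(s / 2)) = E3
    generalize (1 / 2 : ℝ) ^ ((m:ℝ) / 2) = H
    generalize ((Real.sqrt (2 * Real.pi))⁻¹) ^ k = P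
    generalize Real.Gamma (m / 2) = Gm
    have i3 : (g1 * g4) * (h2 * h1) = 1 := by rw [i1, i2, one_mul]
    calc _ = (T1 * R * P * E1 * (H / Gm) * T2 * E2 * (g2 * g3 * E3)) * ((g1 * g4) * (h2 * h1)) := by
          rw [i3, mul_one]
      _ = _ := by ring

lemma meas_gammaPDF (a r : ℝ) : Measurable (gammaPDF a r) :=
  (measurable_gammaPDFReal a r).ennreal_ofReal

lemma lintegral_scale (k : ℕ) {c : ℝ} (hc0 : 0 < c) (f : (Fin k → ℝ) → ENNReal)
    (hf : Measurable f) :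
    ∫⁻ x, f x = ∫⁻ w, ENNReal.ofReal (c ^ k) * f (c • w) := by
  have hmap := Measure.map_addHaar_smul (volume : Measure (Fin k → ℝ)) hc0.ne'
  have hvol : (volume : Measure (Fin k → ℝ)) =
      ENNReal.ofReal (c ^ k) • Measure.map (c • ·) volume := by
    rw [hmap, smul_smul, ← ENNReal.ofReal_mul (by positivity)]
    simp only [Module.finrank_fintype_fun_eq_card, Fintype.card_fin]
    rw [abs_of_pos (by positivity), mul_inv_cancel₀ (by positivity)]
    simp
  have hfc : Measurable (fun w => f (c • w)) := hf.comp (measurable_const_smul c)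
  rw [lintegral_const_mul _ hfc]
  conv_lhs => rw [hvol]
  rw [lintegral_smul_measure, lintegral_map hf (measurable_const_smul c), smul_eq_mul]

lemma lp_main (k m : ℕ) (hm : 3 ≤ m) {r : ℝ} (hr : 0 < r) (A : Set (Fin k → ℝ))
    (hA : MeasurableSet A) :
    ((Measure.pi fun _ : Fin k => gaussianReal 0 1).prod
      (Measure.pi fun _ : Fin m => gaussianReal 0 1))
      {p | (fun i => r / Real.sqrt (∑ j, p.1 j ^ 2 + ∑ j, p.2 j ^ 2) * p.1 i) ∈ A} ≤
    ENNReal.ofReal (lpK ((k + m) / 2) (m / 2) (r ^ 2 / 2)) *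
      (Measure.pi fun _ : Fin k => gaussianReal 0 1) A := by
  have hm0 : (0:ℝ) < m / 2 := by positivity
  have hn0 : (0:ℝ) < (k + m) / 2 := by positivity
  set K := lpK ((k + m) / 2) (m / 2) (r ^ 2 / 2)
  have hK : 0 ≤ K := by
    have hm' : (3:ℝ) ≤ m := by exact_mod_cast hm
    exact (lpK_pos hn0 (by linarith) (by positivity)).le
  have hgam := meas_gammaPDF (m / 2) (1 / 2)
  have hgD : Measurable (gD k) := by unfold gD; fun_prop
  -- the set in terms of the squared norm of the second component
  let B : Set ((Fin k → ℝ) × ℝ) :=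
    {p | (fun i => r / Real.sqrt (∑ j, p.1 j ^ 2 + p.2) * p.1 i) ∈ A}
  have hB : MeasurableSet B := by
    refine measurableSet_preimage (f := fun p : (Fin k → ℝ) × ℝ =>
      (fun i => r / Real.sqrt (∑ j, p.1 j ^ 2 + p.2) * p.1 i)) ?_ hA
    fun_prop
  have hmeasS : Measurable (fun y : Fin m → ℝ => ∑ i, y i ^ 2) := by fun_prop
  have step1 : ((Measure.pi fun _ : Fin k => gaussianReal 0 1).prod
      (Measure.pi fun _ : Fin m => gaussianReal 0 1))
      {p | (fun i => r / Real.sqrt (∑ j, p.1 j ^ 2 + ∑ j, p.2 j ^ 2) * p.1 i) ∈ A} =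
      ((Measure.pi fun _ : Fin k => gaussianReal 0 1).prod (gammaMeasure (m / 2) (1 / 2))) B := by
    rw [← chi_sq m (by omega)]
    have := Measure.map_prod_map (Measure.pi fun _ : Fin k => gaussianReal 0 1)
      (Measure.pi fun _ : Fin m => gaussianReal 0 1) measurable_id hmeasS
    rw [Measure.map_id] at this
    rw [this, Measure.map_apply (by fun_prop) hB]
    rfl
  have step2 : ((Measure.pi fun _ : Fin k => gaussianReal 0 1).prod
      (gammaMeasure (m / 2) (1 / 2))) B =
      ∫⁻ x : Fin k → ℝ, ∫⁻ t : ℝ, ENNReal.ofReal (gD k (∑ j, x j ^ 2)) *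
        (gammaPDF (m / 2) (1 / 2) t * B.indicator 1 (x, t)) := by
    have := isProbabilityMeasure_gammaMeasure hm0 (show (0:ℝ) < 1/2 by norm_num)
    rw [← lintegral_indicator_one hB, lintegral_prod _ (by fun_prop), pi_gaussian_eq,
      lintegral_withDensity_eq_lintegral_mul _ (by fun_prop)]
    · refine lintegral_congr fun x => ?_
      simp only [Pi.mul_apply]
      rw [lintegral_const_mul, gammaMeasure, lintegral_withDensity_eq_lintegral_mul]
      · rfl
      · fun_prop
      · fun_prop
      · fun_prop
    · fun_prop
  have step3 : ∀ x : Fin k → ℝ, ∫⁻ t : ℝ, ENNReal.ofReal (gD k (∑ j, x j ^ 2)) *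
        (gammaPDF (m / 2) (1 / 2) t * B.indicator 1 (x, t)) =
      ∫⁻ t : ℝ, ENNReal.ofReal (gD k (∑ j, x j ^ 2)) *
        (gammaPDF (m / 2) (1 / 2) (t - ∑ j, x j ^ 2) *
          A.indicator 1 (fun i => r / Real.sqrt t * x i)) := by
    intro x
    rw [← lintegral_sub_right_eq_self _ (∑ j, x j ^ 2)]
    refine lintegral_congr fun t => ?_
    congr 2
    have e : ∑ j, x j ^ 2 + (t - ∑ j, x j ^ 2) = t := by ring
    have e' : (x, t - ∑ j, x j ^ 2) ∈ B ↔ (fun i => r / Real.sqrt t * x i) ∈ A := by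
      change (fun i => r / Real.sqrt (∑ j, x j ^ 2 + (t - ∑ j, x j ^ 2)) * x i) ∈ A ↔ _
      rw [e]
    by_cases hx : (fun i => r / Real.sqrt t * x i) ∈ A
    · rw [Set.indicator_of_mem hx, Set.indicator_of_mem (e'.mpr hx)]; rfl
    · rw [Set.indicator_of_notMem hx, Set.indicator_of_notMem (fun h => hx (e'.mp h))]
  have hF : Measurable (fun p : (Fin k → ℝ) × ℝ => ENNReal.ofReal (gD k (∑ j, p.1 j ^ 2)) *
        (gammaPDF (m / 2) (1 / 2) (p.2 - ∑ j, p.1 j ^ 2) *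
          A.indicator 1 (fun i => r / Real.sqrt p.2 * p.1 i))) := by
    have h1 : Measurable (A.indicator (1 : (Fin k → ℝ) → ENNReal)) :=
      measurable_const.indicator hA
    have h2 := meas_gammaPDF (m / 2) (1 / 2)
    fun_prop
  have step4 : ∀ t : ℝ, t ≠ 0 → ∫⁻ x : Fin k → ℝ, ENNReal.ofReal (gD k (∑ j, x j ^ 2)) *
        (gammaPDF (m / 2) (1 / 2) (t - ∑ j, x j ^ 2) *
          A.indicator 1 (fun i => r / Real.sqrt t * x i)) ≤
      ∫⁻ w : Fin k → ℝ, gammaPDF ((k + m) / 2) (1 / 2) t * (ENNReal.ofReal K *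
        (ENNReal.ofReal (gD k (∑ j, w j ^ 2)) * A.indicator 1 w)) := by
    intro t ht
    rcases lt_or_gt_of_ne ht with ht | ht
    · refine le_trans (le_of_eq ?_) zero_le
      refine (lintegral_congr (g := fun _ => 0) fun x => ?_).trans lintegral_zero
      · have : t - ∑ j, x j ^ 2 < 0 := by
          have : 0 ≤ ∑ j, x j ^ 2 := by positivity
          linarith
        simp [gammaPDF_of_neg this]
    · set c : ℝ := Real.sqrt t / r with hc
      have hst : 0 < Real.sqrt t := Real.sqrt_pos.mpr ht
      have hc0 : 0 < c := by positivity
      have hF' : Measurable (fun x : Fin k → ℝ => ENNReal.ofReal (gD k (∑ j, x j ^ 2)) *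
        (gammaPDF (m / 2) (1 / 2) (t - ∑ j, x j ^ 2) *
          A.indicator 1 (fun i => r / Real.sqrt t * x i))) := by
        have h1 : Measurable (A.indicator (1 : (Fin k → ℝ) → ENNReal)) :=
          measurable_const.indicator hA
        fun_prop
      refine (lintegral_scale k hc0 _ hF').trans_le ?_
      refine lintegral_mono fun w => ?_
      have e1 : (fun i => r / Real.sqrt t * (c • w) i) = w := by
        funext i
        simp only [Pi.smul_apply, smul_eq_mul, hc]
        field_simp
      have e2 : ∑ j, (c • w) j ^ 2 = t / r ^ 2 * ∑ j, w j ^ 2 := by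
        simp only [Pi.smul_apply, smul_eq_mul, mul_pow, hc, div_pow, Real.sq_sqrt ht.le,
          Finset.mul_sum]
      rw [e1, e2]
      by_cases hw : w ∈ A
      · simp only [Set.indicator, hw, if_true, Pi.one_apply, mul_one]
        unfold gammaPDF
        rw [← ENNReal.ofReal_mul (gD_nonneg _ _), ← ENNReal.ofReal_mul (by positivity),
          ← ENNReal.ofReal_mul hK, ← ENNReal.ofReal_mul (gammaPDFReal_nonneg hn0 (by norm_num) _)]
        refine ENNReal.ofReal_le_ofReal ((lp_pointwise k m hm hr ht).trans (le_of_eq ?_))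
        ring
      · simp [Set.indicator, hw]
  rw [step1, step2]
  simp_rw [step3]
  rw [lintegral_lintegral_swap hF.aemeasurable]
  calc _ ≤ ∫⁻ t : ℝ, ∫⁻ w : Fin k → ℝ, gammaPDF ((k + m) / 2) (1 / 2) t * (ENNReal.ofReal K *
        (ENNReal.ofReal (gD k (∑ j, w j ^ 2)) * A.indicator 1 w)) := by
        refine lintegral_mono_ae ?_
        filter_upwards [Measure.ae_ne volume (0:ℝ)] with t ht
        exact step4 t ht
    _ = _ := by
        have h1 : Measurable (A.indicator (1 : (Fin k → ℝ) → ENNReal)) :=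
          measurable_const.indicator hA
        have h2 : ∀ t : ℝ, ∫⁻ w : Fin k → ℝ, gammaPDF ((k + m) / 2) (1 / 2) t * (ENNReal.ofReal K *
        (ENNReal.ofReal (gD k (∑ j, w j ^ 2)) * A.indicator 1 w)) =
          gammaPDF ((k + m) / 2) (1 / 2) t * (ENNReal.ofReal K *
            (Measure.pi fun _ : Fin k => gaussianReal 0 1) A) := by
          intro t
          rw [lintegral_const_mul _ (by fun_prop), lintegral_const_mul _ (by fun_prop),
            pi_gaussian_eq, withDensity_apply _ hA, ← lintegral_indicator hA]
          congr 3
          funext w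
          by_cases hw : w ∈ A <;> simp [Set.indicator, hw]
        simp_rw [h2]
        rw [lintegral_mul_const _ (meas_gammaPDF _ _),
          lintegral_gammaPDF_eq_one hn0 (by norm_num), one_mul]

lemma pi_append (k m : ℕ) :
    (Measure.pi fun _ : Fin (k + m) => gaussianReal 0 1) =
      ((Measure.pi fun _ : Fin k => gaussianReal 0 1).prod
        (Measure.pi fun _ : Fin m => gaussianReal 0 1)).map (fun p => Fin.append p.1 p.2) := by
  have hme : Measurable (fun p : (Fin k → ℝ) × (Fin m → ℝ) => Fin.append p.1 p.2) := by
    rw [measurable_pi_iff]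
    intro i
    refine Fin.addCases (fun i => ?_) (fun i => ?_) i
    · simp only [Fin.append_left]; fun_prop
    · simp only [Fin.append_right]; fun_prop
  refine Measure.pi_eq fun s hs => ?_
  rw [Measure.map_apply hme (MeasurableSet.univ_pi hs)]
  have : (fun p : (Fin k → ℝ) × (Fin m → ℝ) => Fin.append p.1 p.2) ⁻¹' Set.univ.pi s =
      (Set.univ.pi fun i => s (Fin.castAdd m i)) ×ˢ (Set.univ.pi fun i => s (Fin.natAdd k i)) := by
    ext p
    simp only [Set.mem_preimage, Set.mem_pi, Set.mem_univ, true_imp_iff, Set.mem_prod]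
    constructor
    · intro h
      exact ⟨fun i => by simpa using h (Fin.castAdd m i), fun i => by simpa using h (Fin.natAdd k i)⟩
    · rintro ⟨h1, h2⟩ i
      refine Fin.addCases (fun i => ?_) (fun i => ?_) i
      · simpa using h1 i
      · simpa using h2 i
  rw [this, Measure.prod_prod, Measure.pi_pi, Measure.pi_pi, Fin.prod_univ_add]

lemma lp_Q_le (k m : ℕ) (hm : 3 ≤ m) {r : ℝ} (hr : 0 < r) (A : Set (Fin k → ℝ))
    (hA : MeasurableSet A) :
    (Measure.map
      (fun z : Fin (k + m) → ℝ => fun i : Fin k =>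
        (r / Real.sqrt (∑ j, z j ^ 2)) * z ⟨i.1, by omega⟩)
      (Measure.pi fun _ : Fin (k + m) => gaussianReal 0 1)) A ≤
    ENNReal.ofReal (lpK ((k + m) / 2) (m / 2) (r ^ 2 / 2)) *
      (Measure.pi fun _ : Fin k => gaussianReal 0 1) A := by
  have hme : Measurable (fun p : (Fin k → ℝ) × (Fin m → ℝ) => Fin.append p.1 p.2) := by
    rw [measurable_pi_iff]
    intro i
    refine Fin.addCases (fun i => ?_) (fun i => ?_) i
    · simp only [Fin.append_left]; fun_prop
    · simp only [Fin.append_right]; fun_prop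
  refine le_trans (le_of_eq ?_) (lp_main k m hm hr A hA)
  have hf : Measurable (fun z : Fin (k + m) → ℝ => fun i : Fin k =>
        (r / Real.sqrt (∑ j, z j ^ 2)) * z ⟨i.1, by omega⟩) := by fun_prop
  rw [pi_append, Measure.map_map hf hme, Measure.map_apply (hf.comp hme) hA]
  congr 1
  ext p
  simp only [Set.mem_preimage, Function.comp, Set.mem_ofPred_eq, Fin.sum_univ_add,
    Fin.append_left, Fin.append_right]
  have : ∀ i : Fin k, Fin.append p.1 p.2 ⟨i.1, by omega⟩ = p.1 i := fun i =>
    Fin.append_left p.1 p.2 i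
  simp only [this]

/-- Total variation bound from a one-sided density bound. -/
lemma tv_le {X : Type*} [MeasurableSpace X] (Q P : Measure X) [IsProbabilityMeasure Q]
    [IsProbabilityMeasure P] {K : ℝ} (hK : 0 < K)
    (h : ∀ A : Set X, MeasurableSet A → Q A ≤ ENNReal.ofReal K * P A) :
    tvDist Q P ≤ 1 - 1 / K := by
  have h1 : ∀ A : Set X, MeasurableSet A → Q.real A - P.real A ≤ 1 - 1 / K := by
    intro A hA
    have hr : Q.real A ≤ K * P.real A := by
      have := ENNReal.toReal_mono (by finiteness) (h A hA)
      rwa [ENNReal.toReal_mul, ENNReal.toReal_ofReal hK.le] at this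
    have hu : 1 ≤ K := by
      have := ENNReal.toReal_mono (by finiteness) (h Set.univ MeasurableSet.univ)
      simpa [ENNReal.toReal_ofReal hK.le] using this
    have hq : Q.real A ≤ 1 := measureReal_le_one
    have hp : Q.real A / K ≤ P.real A := by rwa [div_le_iff₀ hK, mul_comm]
    have hk : 1 / K ≤ 1 := by rw [div_le_one hK]; exact hu
    have : Q.real A * (1 - 1 / K) ≤ 1 * (1 - 1 / K) :=
      mul_le_mul_of_nonneg_right hq (by linarith)
    have e : Q.real A * (1 - 1 / K) = Q.real A - Q.real A / K := by ring
    linarith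
  unfold tvDist
  refine ciSup_le fun A => ?_
  change |Q.real A.1 - P.real A.1| ≤ _
  rw [abs_le']
  refine ⟨h1 _ A.2, ?_⟩
  have := h1 _ A.2.compl
  rw [probReal_compl_eq_one_sub A.2, probReal_compl_eq_one_sub A.2] at this
  linarith

/-- Corollary 1 (Lévy–Poincaré projection): let `Q_{n,k}` be the law of
`r_n·(U_1,…,U_k)` for `U` uniform on the unit sphere of `ℝⁿ` (realized as the
pushforward of the `n`-fold product standard Gaussian under
`z ↦ (r_n/‖z‖)(z_1,…,z_k)`), and `P_k` the `k`-fold product standard Gaussian.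
If `r_n = √n`, `δ = (k+2)/n`, or `r_n = √(n-2)`, `δ = k/(n-2)`, then
`Q_{n,k}(A) ≤ (1-δ)^{-1/2} P_k(A)` for all Borel `A`, and
`d_TV(Q_{n,k}, P_k) < 1 - √(1-δ) < δ/(2-δ)`. -/
theorem levy_poincare_projection (n k : ℕ) (hk : 1 ≤ k) (hnk : k + 2 < n)
    (r δ : ℝ)
    (hcase : (r = Real.sqrt n ∧ δ = ((k : ℝ) + 2) / n) ∨
             (r = Real.sqrt ((n : ℝ) - 2) ∧ δ = (k : ℝ) / ((n : ℝ) - 2)))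
    (Q : Measure (Fin k → ℝ)) (P : Measure (Fin k → ℝ))
    (hQ : Q = Measure.map
      (fun z : Fin n → ℝ => fun i : Fin k =>
        (r / Real.sqrt (∑ j, z j ^ 2)) * z ⟨i.1, by omega⟩)
      (Measure.pi fun _ : Fin n => gaussianReal 0 1))
    (hP : P = Measure.pi fun _ : Fin k => gaussianReal 0 1) :
    (∀ A : Set (Fin k → ℝ), MeasurableSet A →
      Q A ≤ ENNReal.ofReal ((1 - δ) ^ (-(1 / 2) : ℝ)) * P A) ∧
    tvDist Q P < 1 - Real.sqrt (1 - δ) ∧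
    1 - Real.sqrt (1 - δ) < δ / (2 - δ) := by
  obtain ⟨m, rfl⟩ : ∃ m, n = k + m := ⟨n - k, by omega⟩
  have hm : 3 ≤ m := by omega
  have hm' : (3:ℝ) ≤ m := by exact_mod_cast hm
  have hk' : (1:ℝ) ≤ k := by exact_mod_cast hk
  have ha : (0:ℝ) < (k + m) / 2 := by positivity
  have hb : (1:ℝ) < m / 2 := by linarith
  -- common features of the two cases
  have hcom : 0 < r ∧ (m:ℝ) / 2 - 1 < r ^ 2 / 2 ∧
      Real.Gamma ((k + m) / 2) = Real.Gamma (r ^ 2 / 2) * (r ^ 2 / 2) ^ (((k:ℝ) + m) / 2 - r ^ 2 / 2)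
      ∧ 1 - δ = ((m:ℝ) / 2 - 1) / (r ^ 2 / 2) := by
    rcases hcase with ⟨hr, hδ⟩ | ⟨hr, hδ⟩
    · push_cast at hr hδ
      have h2 : r ^ 2 = k + m := by rw [hr, Real.sq_sqrt (by positivity)]
      refine ⟨?_, ?_, ?_, ?_⟩
      · rw [hr]; apply Real.sqrt_pos.mpr; linarith
      · rw [h2]; linarith
      · rw [h2, sub_self, Real.rpow_zero, mul_one]
      · rw [h2, hδ]; field_simp; ring
    · push_cast at hr hδ
      have h0 : (0:ℝ) < k + m - 2 := by linarith
      have h2 : r ^ 2 = k + m - 2 := by rw [hr, Real.sq_sqrt h0.le]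
      refine ⟨?_, ?_, ?_, ?_⟩
      · rw [hr]; exact Real.sqrt_pos.mpr h0
      · rw [h2]; linarith
      · have e : ((k:ℝ) + m) / 2 = (k + m - 2) / 2 + 1 := by ring
        rw [h2, e, Real.Gamma_add_one (by positivity), add_sub_cancel_left, Real.rpow_one, mul_comm]
      · rw [h2, hδ]; field_simp; ring
  obtain ⟨hr, hlt, hG, hδ⟩ := hcom
  have hρ : 0 < r ^ 2 / 2 := by positivity
  have hKpos := lpK_pos ha hb hρ
  have hKlt := lpK_lt ha hb hlt hG
  rw [← hδ] at hKlt
  have hd0 : 0 < 1 - δ := by rw [hδ]; exact div_pos (by linarith) hρ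
  have hd1 : 1 - δ < 1 := by rw [hδ, div_lt_one hρ]; exact hlt
  have hQK : ∀ A : Set (Fin k → ℝ), MeasurableSet A →
      Q A ≤ ENNReal.ofReal (lpK ((k + m) / 2) (m / 2) (r ^ 2 / 2)) * P A := by
    intro A hA
    rw [hQ, hP]
    exact lp_Q_le k m hm hr A hA
  have hP1 : IsProbabilityMeasure P := by rw [hP]; infer_instance
  have hQ1 : IsProbabilityMeasure Q := by
    rw [hQ]
    exact Measure.isProbabilityMeasure_map (Measurable.aemeasurable (by fun_prop))
  refine ⟨fun A hA => (hQK A hA).trans ?_, ?_, ?_⟩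
  · gcongr
  · refine (tv_le Q P hKpos hQK).trans_lt ?_
    have h1 : (1 - δ) ^ (-(1 / 2) : ℝ) = 1 / Real.sqrt (1 - δ) := by
      rw [Real.rpow_neg hd0.le, ← Real.sqrt_eq_rpow, one_div]
    rw [h1] at hKlt
    have hs : 0 < Real.sqrt (1 - δ) := Real.sqrt_pos.mpr hd0
    have := (lt_one_div hKpos hs).mp hKlt
    linarith
  · have hs : 0 < Real.sqrt (1 - δ) := Real.sqrt_pos.mpr hd0
    have hs2 := Real.sq_sqrt hd0.le
    have hs1 : Real.sqrt (1 - δ) < 1 := by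
      rw [Real.sqrt_lt' one_pos]; linarith
    rw [lt_div_iff₀ (by linarith)]
    generalize Real.sqrt (1 - δ) = s at *
    have : δ = 1 - s ^ 2 := by linarith
    subst this
    nlinarith [mul_pos hs (sub_pos.mpr hs1), mul_pos (mul_pos hs (sub_pos.mpr hs1)) (sub_pos.mpr hs1)]
end
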